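/- Fix σ > 0 and c > 0. With N_k(μ) := #{n ∈ ℤ : n ≥ c·k and (n, k − 3/4) ∈ μD} and N_k′(μ) := #{n ∈ ℤ : n ≥ c·k and #{t ∈ (0,μ] : φ_{n,σ}(t) = 0} ≥ k}, there exist C > 0 and μ₀ > 0 such that for all μ ≥ μ₀ and all integers k > μ^{4/7}: N_k(μ − C·μ^{−3/7}) ≤ N_k′(μ) ≤ N_k(μ + C·μ^{−3/7}). -/

import Mathlib

open Real MeasureTheory Pointwise

/-- The Bessel function of integer order `n`: `J_n(x) = (1/π)∫₀^π cos(x sin t − n t) dt`. -/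
noncomputable def besselJ (n : ℕ) (x : ℝ) : ℝ :=
  (1 / π) * ∫ t in (0:ℝ)..π, Real.cos (x * Real.sin t - n * t)

/-- The derivative `J_n′` of the Bessel function. -/
noncomputable def besselJ' (n : ℕ) (x : ℝ) : ℝ := deriv (besselJ n) x

/-- `φ_{n,σ}(x) = x·J_n′(x) + σ·J_n(x)`. -/
noncomputable def phiRobin (σ : ℝ) (n : ℕ) (x : ℝ) : ℝ :=
  x * besselJ' n x + σ * besselJ n x

/-- `g(x) = (1/π)(√(1−x²) − x·arccos x)`. -/
noncomputable def gfun (x : ℝ) : ℝ :=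
  (1 / π) * (Real.sqrt (1 - x ^ 2) - x * Real.arccos x)

/-- The cusped domain `D = {(x,y) : −1 ≤ x ≤ 1, max(0,−x) ≤ y ≤ g(x)}`. -/
def domD : Set (ℝ × ℝ) :=
  {p | -1 ≤ p.1 ∧ p.1 ≤ 1 ∧ max 0 (-p.1) ≤ p.2 ∧ p.2 ≤ gfun p.1}

/-- `N_k(μ) = #{n ∈ ℤ : n ≥ c·k, (n, k − 3/4) ∈ μD}`. -/
noncomputable def latticeCountRow (c : ℝ) (k : ℕ) (μ : ℝ) : ℕ :=
  ({n : ℤ | c * (k : ℝ) ≤ (n : ℝ) ∧ ((n : ℝ), (k : ℝ) - 3/4) ∈ μ • domD}).ncard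

/-- `N_k′(μ) = #{n ∈ ℤ : n ≥ c·k, #{t ∈ (0,μ] : φ_{n,σ}(t) = 0} ≥ k}`. -/
noncomputable def diskRobinCountRow (σ c : ℝ) (k : ℕ) (μ : ℝ) : ℕ :=
  ({n : ℤ | c * (k : ℝ) ≤ (n : ℝ) ∧
    k ≤ ({t : ℝ | t ∈ Set.Ioc 0 μ ∧ phiRobin σ n.natAbs t = 0}).ncard}).ncard

lemma bj_deriv0 (n : ℕ) (x : ℝ) : HasDerivAt (besselJ n)
    ((1 / π) * ∫ t in (0:ℝ)..π, -(Real.sin t * Real.sin (x * Real.sin t - n * t))) x := by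
  unfold besselJ
  apply HasDerivAt.const_mul
  refine (intervalIntegral.hasDerivAt_integral_of_dominated_loc_of_deriv_le (s := Set.univ)
    (F' := fun x t => -(Real.sin t * Real.sin (x * Real.sin t - n * t))) (bound := fun _ => 1)
    Filter.univ_mem ?_ ?_ ?_ ?_ ?_ ?_).2
  · refine Filter.Eventually.of_forall fun y => Continuous.aestronglyMeasurable (by fun_prop)
  · exact Continuous.intervalIntegrable (by fun_prop) _ _
  · exact Continuous.aestronglyMeasurable (by fun_prop)
  · refine Filter.Eventually.of_forall fun t _ y _ => ?_
    rw [norm_neg, norm_mul]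
    have h1 : ‖Real.sin t‖ ≤ 1 := Real.abs_sin_le_one t
    have h2 : ‖Real.sin (y * Real.sin t - n * t)‖ ≤ 1 := Real.abs_sin_le_one _
    nlinarith [norm_nonneg (Real.sin t), norm_nonneg (Real.sin (y * Real.sin t - n * t))]
  · exact Continuous.intervalIntegrable (by fun_prop) _ _
  · refine Filter.Eventually.of_forall fun t _ y _ => ?_
    have := (((hasDerivAt_id y).mul_const (Real.sin t)).sub_const ((n:ℝ) * t)).cos
    refine this.congr_deriv ?_
    simp only [id, one_mul]; ring

lemma bj_int0 (n : ℕ) (x : ℝ) :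
    ∫ t in (0:ℝ)..π, (x * Real.cos t - n) * Real.cos (x * Real.sin t - n * t) = 0 := by
  have h : ∀ t ∈ Set.uIcc (0:ℝ) π, HasDerivAt (fun t => Real.sin (x * Real.sin t - n * t))
      ((x * Real.cos t - n) * Real.cos (x * Real.sin t - n * t)) t := by
    intro t _
    have := (((Real.hasDerivAt_sin t).const_mul x).sub ((hasDerivAt_id t).const_mul (n:ℝ))).sin
    refine this.congr_deriv ?_
    simp only [id, Pi.sub_apply]; ring
  rw [intervalIntegral.integral_eq_sub_of_hasDerivAt h
    (Continuous.intervalIntegrable (by fun_prop) _ _)]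
  simp [Real.sin_nat_mul_pi]

lemma bj_d1 (n : ℕ) (x : ℝ) : x * deriv (besselJ n) x = n * besselJ n x - x * besselJ (n+1) x := by
  rw [(bj_deriv0 n x).deriv]
  unfold besselJ
  have h : ∫ t in (0:ℝ)..π, (x * -(Real.sin t * Real.sin (x * Real.sin t - n * t))
      - n * Real.cos (x * Real.sin t - n * t) + x * Real.cos (x * Real.sin t - (n+1:ℕ) * t))
      = ∫ t in (0:ℝ)..π, (x * Real.cos t - n) * Real.cos (x * Real.sin t - n * t) := by
    congr 1; ext t
    have : x * Real.sin t - (n+1:ℕ) * t = (x * Real.sin t - n * t) - t := by push_cast; ring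
    rw [this, Real.cos_sub (x * Real.sin t - n * t) t]; ring
  rw [bj_int0, intervalIntegral.integral_add, intervalIntegral.integral_sub,
    intervalIntegral.integral_const_mul, intervalIntegral.integral_const_mul,
    intervalIntegral.integral_const_mul] at h
  · linear_combination (1/π) * h
  all_goals exact Continuous.intervalIntegrable (by fun_prop) _ _

lemma bj_d2 (n : ℕ) (x : ℝ) :
    x * deriv (besselJ (n+1)) x = x * besselJ n x - (n+1) * besselJ (n+1) x := by
  rw [(bj_deriv0 (n+1) x).deriv]
  unfold besselJ
  have h : ∫ t in (0:ℝ)..π, (x * -(Real.sin t * Real.sin (x * Real.sin t - (n+1:ℕ) * t))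
      + (n+1:ℕ) * Real.cos (x * Real.sin t - (n+1:ℕ) * t) - x * Real.cos (x * Real.sin t - n * t))
      = ∫ t in (0:ℝ)..π, -((x * Real.cos t - (n+1:ℕ)) * Real.cos (x * Real.sin t - (n+1:ℕ) * t)) := by
    congr 1; ext t
    have : x * Real.sin t - n * t = (x * Real.sin t - (n+1:ℕ) * t) + t := by push_cast; ring
    rw [this, Real.cos_add (x * Real.sin t - (n+1:ℕ) * t) t]; ring
  rw [intervalIntegral.integral_neg, bj_int0, intervalIntegral.integral_sub,
    intervalIntegral.integral_add,
    intervalIntegral.integral_const_mul, intervalIntegral.integral_const_mul,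
    intervalIntegral.integral_const_mul] at h
  · push_cast at h ⊢
    linear_combination (1/π) * h
  all_goals exact Continuous.intervalIntegrable (by fun_prop) _ _

lemma bj_J (n : ℕ) (x : ℝ) (hx : 0 < x) :
    HasDerivAt (besselJ n) (x * deriv (besselJ n) x / x) x := by
  rw [mul_div_cancel_left₀ _ hx.ne']
  exact (bj_deriv0 n x).differentiableAt.hasDerivAt

lemma bj_V (n : ℕ) (x : ℝ) (hx : 0 < x) :
    HasDerivAt (fun x => x * deriv (besselJ n) x) (-(x^2 - (n:ℝ)^2)/x * besselJ n x) x := by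
  have e : (fun x => x * deriv (besselJ n) x) = fun x => n * besselJ n x - x * besselJ (n+1) x :=
    funext (bj_d1 n)
  rw [e]
  have h0 := (bj_deriv0 n x).differentiableAt.hasDerivAt
  have h1 := (bj_deriv0 (n+1) x).differentiableAt.hasDerivAt
  refine ((h0.const_mul (n:ℝ)).sub ((hasDerivAt_id x).mul h1)).congr_deriv ?_
  have e1 := bj_d1 n x
  have e2 := bj_d2 n x
  simp only [id]
  rw [e2]
  have : deriv (besselJ n) x = (n * besselJ n x - x * besselJ (n+1) x)/x := by
    rw [← e1]; field_simp
  rw [this]; field_simp; ring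
lemma gauss_tail (b : ℂ) (hb : 0 < b.re) :
    ‖∫ v in Set.Ioi (1:ℝ), Complex.exp (-b * (v:ℂ)^2)‖ ≤ 1 / ‖b‖ := by
  have hb0 : b ≠ 0 := by rintro rfl; simp at hb
  have hI : Integrable (fun v : ℝ => Complex.exp (-b * (v:ℂ)^2)) := integrable_cexp_neg_mul_sq hb
  have hle : ∀ v : ℝ, ‖Complex.exp (-b * (v:ℂ)^2)‖ ≤ 1 := by
    intro v
    rw [norm_cexp_neg_mul_sq, Real.exp_le_one_iff]
    nlinarith [sq_nonneg v, mul_nonneg hb.le (sq_nonneg v)]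
  have hbd : ∀ v ∈ Set.Ioi (1:ℝ), ‖Complex.exp (-b * (v:ℂ)^2) / (2 * b * (v:ℂ)^2)‖ ≤
      (1 / (2 * ‖b‖)) * v ^ (-2:ℝ) := by
    intro v hv
    have hv0 : (0:ℝ) < v := lt_trans one_pos hv
    have hv2 : v ^ (-2:ℝ) = (v^2)⁻¹ := by
      rw [Real.rpow_neg hv0.le]; norm_num
    rw [hv2, norm_div, norm_mul, norm_mul, norm_pow, Complex.norm_real, Real.norm_of_nonneg hv0.le]
    simp only [Complex.norm_ofNat]
    have hbp : 0 < ‖b‖ := norm_pos_iff.2 hb0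
    rw [show 1 / (2 * ‖b‖) * (v^2)⁻¹ = 1 / (2 * ‖b‖ * v^2) by field_simp]
    gcongr
    exact hle v
  have hpI : IntegrableOn (fun v : ℝ => (1 / (2 * ‖b‖)) * v ^ (-2:ℝ)) (Set.Ioi 1) :=
    (integrableOn_Ioi_rpow_of_lt (by norm_num) one_pos).const_mul _
  have hI2 : IntegrableOn (fun v : ℝ => Complex.exp (-b * (v:ℂ)^2) / (2 * b * (v:ℂ)^2))
      (Set.Ioi 1) := by
    refine Integrable.mono' hpI ?_ ((ae_restrict_iff' measurableSet_Ioi).2 (Filter.Eventually.of_forall hbd))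
    refine ContinuousOn.aestronglyMeasurable ?_ measurableSet_Ioi
    refine ContinuousOn.div (by fun_prop) (by fun_prop) ?_
    intro v hv
    have hv0 : (0:ℝ) < v := lt_trans one_pos hv
    have : (v:ℂ) ≠ 0 := by exact_mod_cast hv0.ne'
    simp [hb0, this]
  have hder : ∀ v ∈ Set.Ici (1:ℝ), HasDerivAt (fun v : ℝ => Complex.exp (-b * (v:ℂ)^2) / (2 * b * (v:ℂ)))
      (-(Complex.exp (-b * (v:ℂ)^2) + Complex.exp (-b * (v:ℂ)^2) / (2 * b * (v:ℂ)^2))) v := by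
    intro v hv
    have hv0 : (0:ℝ) < v := lt_of_lt_of_le one_pos hv
    have hv' : (v:ℂ) ≠ 0 := by exact_mod_cast hv0.ne'
    have h : HasDerivAt (fun z : ℂ => Complex.exp (-b * z^2) / (2 * b * z)) 
      (-(Complex.exp (-b * (v:ℂ)^2) + Complex.exp (-b * (v:ℂ)^2) / (2 * b * (v:ℂ)^2))) (v:ℂ) := by
      refine (((((hasDerivAt_id (v:ℂ)).pow 2).const_mul (-b)).cexp).div
        ((hasDerivAt_id (v:ℂ)).const_mul (2*b)) (by simp [hb0, hv'])).congr_deriv ?_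
      simp only [id, Pi.pow_apply]
      field_simp
      push_cast
      ring
    exact h.comp_ofReal
  have hlim : Filter.Tendsto (fun v : ℝ => Complex.exp (-b * (v:ℂ)^2) / (2 * b * (v:ℂ)))
      Filter.atTop (nhds 0) := by
    have h0 : Filter.Tendsto (fun v : ℝ => (1 / (2 * ‖b‖)) * v⁻¹) Filter.atTop (nhds 0) := by
      simpa using tendsto_inv_atTop_zero.const_mul (1 / (2 * ‖b‖))
    refine squeeze_zero_norm' ?_ h0
    filter_upwards [Filter.eventually_gt_atTop 0] with v hv
    have hbp : 0 < ‖b‖ := norm_pos_iff.2 hb0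
    rw [norm_div, norm_mul, norm_mul, Complex.norm_real, Real.norm_of_nonneg hv.le]
    simp only [Complex.norm_ofNat]
    rw [show 1 / (2 * ‖b‖) * v⁻¹ = 1 / (2 * ‖b‖ * v) by field_simp]
    gcongr
    exact hle v
  have hFTC := integral_Ioi_of_hasDerivAt_of_tendsto' hder ((hI.integrableOn.add hI2).neg) hlim
  rw [integral_neg, integral_add hI.integrableOn hI2] at hFTC
  have e : ∫ v in Set.Ioi (1:ℝ), Complex.exp (-b * (v:ℂ)^2) =
      Complex.exp (-b * ((1:ℝ):ℂ)^2) / (2 * b * ((1:ℝ):ℂ)) -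
        ∫ v in Set.Ioi (1:ℝ), Complex.exp (-b * (v:ℂ)^2) / (2 * b * (v:ℂ)^2) := by
    linear_combination -hFTC
  have hbp : 0 < ‖b‖ := norm_pos_iff.2 hb0
  have n1 : ‖Complex.exp (-b * ((1:ℝ):ℂ)^2) / (2 * b * ((1:ℝ):ℂ))‖ ≤ 1 / (2 * ‖b‖) := by
    rw [norm_div, norm_mul, norm_mul]
    simp only [Complex.norm_ofNat, Complex.norm_real, norm_one, mul_one]
    gcongr
    exact hle 1
  have n2 : ‖∫ v in Set.Ioi (1:ℝ), Complex.exp (-b * (v:ℂ)^2) / (2 * b * (v:ℂ)^2)‖ ≤ 1 / (2 * ‖b‖) := by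
    refine (norm_integral_le_of_norm_le hpI ((ae_restrict_iff' measurableSet_Ioi).2 (Filter.Eventually.of_forall hbd))).trans ?_
    rw [integral_const_mul, integral_Ioi_rpow_of_lt (by norm_num) one_pos]
    norm_num
  rw [e]
  calc _ ≤ _ := norm_sub_le _ _
    _ ≤ 1 / (2 * ‖b‖) + 1 / (2 * ‖b‖) := add_le_add n1 n2
    _ = _ := by field_simp; norm_num

lemma gauss_fin (b : ℂ) (hb : 0 < b.re) :
    ‖(∫ v in (0:ℝ)..1, Complex.exp (-b * (v:ℂ)^2)) - (π / b) ^ (1/2:ℂ) / 2‖ ≤ 1 / ‖b‖ := by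
  have hI : Integrable (fun v : ℝ => Complex.exp (-b * (v:ℂ)^2)) := integrable_cexp_neg_mul_sq hb
  have h := intervalIntegral.integral_interval_add_Ioi (a := 0) (b := 1) hI.integrableOn hI.integrableOn
  rw [integral_gaussian_complex_Ioi hb] at h
  rw [← h]
  simpa using gauss_tail b hb

lemma fresnel (x : ℝ) (hx : 0 < x) :
    ‖(∫ v in (0:ℝ)..1, Complex.exp (-(x * Complex.I) * (v:ℂ)^2)) -
      (√π / 2 * Complex.exp (-(π/4) * Complex.I)) / √x‖ ≤ 1 / x := by
  have hx' : (x:ℂ) ≠ 0 := by exact_mod_cast hx.ne'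
  have key : ‖(∫ v in (0:ℝ)..1, Complex.exp (-(x * Complex.I) * (v:ℂ)^2)) -
      (π / (x * Complex.I)) ^ (1/2:ℂ) / 2‖ ≤ 1 / ‖(x * Complex.I : ℂ)‖ := by
    have hne : (x * Complex.I : ℂ) ≠ 0 := by simp [hx']
    have ht : Filter.Tendsto (fun e : ℝ => (x * Complex.I + e : ℂ)) (nhdsWithin 0 (Set.Ioi 0))
        (nhds (x * Complex.I)) := by
      have : Continuous (fun e : ℝ => (x * Complex.I + e : ℂ)) := by fun_prop
      have := (this.tendsto 0).mono_left (nhdsWithin_le_nhds (s := Set.Ioi 0))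
      simpa using this
    have hc : ContinuousAt (fun b : ℂ => ‖(∫ v in (0:ℝ)..1, Complex.exp (-b * (v:ℂ)^2)) -
      (π / b) ^ (1/2:ℂ) / 2‖) (x * Complex.I) := by
      apply ContinuousAt.norm
      apply ContinuousAt.sub
      · apply Continuous.continuousAt
        apply intervalIntegral.continuous_parametric_intervalIntegral_of_continuous'
        fun_prop
      · apply ContinuousAt.div_const
        refine ContinuousAt.cpow (continuousAt_const.div continuousAt_id hne) continuousAt_const ?_
        · right
          rw [Complex.div_im]
          simp
          exact hx.ne'
    have hc2 : ContinuousAt (fun b : ℂ => 1 / ‖b‖) (x * Complex.I) :=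
      continuousAt_const.div continuousAt_id.norm (by simpa using hx')
    refine le_of_tendsto_of_tendsto (hc.tendsto.comp ht) (hc2.tendsto.comp ht) ?_
    filter_upwards [self_mem_nhdsWithin] with e he
    exact gauss_fin _ (by simpa using he)
  have e : (π / (x * Complex.I) : ℂ) ^ (1/2:ℂ) = √π * Complex.exp (-(π/4) * Complex.I) / √x := by
    have h1 : (π / (x * Complex.I) : ℂ) = ((π/x : ℝ) : ℂ) * (-Complex.I) := by
      push_cast; rw [← div_div, Complex.div_I]; ring
    have hp : 0 < π/x := div_pos Real.pi_pos hx
    have hlog : Complex.exp ((1/2:ℂ) * (Real.log (π/x) : ℝ)) = ((√π / √x : ℝ) : ℂ) := by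
      rw [← Real.sqrt_div Real.pi_pos.le, Real.sqrt_eq_rpow, Real.rpow_def_of_pos hp]
      push_cast
      congr 1; ring
    rw [h1, Complex.cpow_def_of_ne_zero (by simp [hx.ne', Real.pi_ne_zero]),
      Complex.log_ofReal_mul hp (by simp), Complex.log_neg_I,
      show ((Real.log (π/x) : ℝ) + -(π/2) * Complex.I) * (1/2:ℂ) =
        (1/2:ℂ) * (Real.log (π/x) : ℝ) + (-(π/4) * Complex.I) by ring, Complex.exp_add, hlog]
    push_cast
    ring
  rw [e] at key
  simp only [norm_mul, Complex.norm_real, Complex.norm_I, mul_one, Real.norm_of_nonneg hx.le] at key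
  convert key using 3
  ring
lemma osc_parts (h h' : ℝ → ℝ) (hd : ∀ u ∈ Set.uIcc (-(π/2)) (π/2), HasDerivAt h (h' u) u)
    (hc : ContinuousOn h' (Set.uIcc (-(π/2)) (π/2))) :
    ∃ K, ∀ x : ℝ, 0 < x → ‖∫ u in (-(π/2))..(π/2),
      ((Real.sin u * h u : ℝ) : ℂ) * Complex.exp (x * Real.cos u * Complex.I)‖ ≤ K / x := by
  refine ⟨|h (π/2)| + |h (-(π/2))| + ∫ u in (-(π/2))..(π/2), |h' u|, fun x hx => ?_⟩
  have hn : ∀ u : ℝ, ‖Complex.exp (x * Real.cos u * Complex.I)‖ = 1 := by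
    intro u
    rw [show (x * Real.cos u * Complex.I : ℂ) = ((x * Real.cos u : ℝ) : ℂ) * Complex.I by push_cast; ring]
    exact Complex.norm_exp_ofReal_mul_I _
  have hv : ∀ u ∈ Set.uIcc (-(π/2)) (π/2), HasDerivAt
      (fun u : ℝ => Complex.exp (x * Real.cos u * Complex.I))
      (-(x * Real.sin u * Complex.I) * Complex.exp (x * Real.cos u * Complex.I)) u := by
    intro u _
    have := ((((Real.hasDerivAt_cos u).ofReal_comp).const_mul (x:ℂ)).mul_const Complex.I).cexp
    refine this.congr_deriv ?_
    push_cast; ring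
  have hu : ∀ u ∈ Set.uIcc (-(π/2)) (π/2), HasDerivAt (fun u : ℝ => (h u : ℂ)) ((h' u : ℝ) : ℂ) u :=
    fun u hu => (hd u hu).ofReal_comp
  have hci : IntervalIntegrable (fun u => ((h' u : ℝ) : ℂ)) volume (-(π/2)) (π/2) :=
    (Complex.continuous_ofReal.comp_continuousOn hc).intervalIntegrable
  have hp := intervalIntegral.integral_mul_deriv_eq_deriv_mul hu hv hci
    (Continuous.intervalIntegrable (by fun_prop) _ _)
  have e : ∫ u in (-(π/2))..(π/2), (h u : ℂ) * (-(x * Real.sin u * Complex.I) * Complex.exp (x * Real.cos u * Complex.I))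
      = (-(x * Complex.I)) * ∫ u in (-(π/2))..(π/2),
      ((Real.sin u * h u : ℝ) : ℂ) * Complex.exp (x * Real.cos u * Complex.I) := by
    rw [← intervalIntegral.integral_const_mul]
    congr 1; ext u; push_cast; ring
  rw [e] at hp
  have hle : -(π/2) ≤ π/2 := by linarith [Real.pi_pos]
  have h1 := congrArg norm hp
  rw [norm_mul, norm_neg, norm_mul, Complex.norm_I, mul_one, Complex.norm_real, Real.norm_of_nonneg hx.le] at h1
  rw [le_div_iff₀ hx, mul_comm, h1]
  refine (norm_sub_le _ _).trans (add_le_add ((norm_sub_le _ _).trans ?_) ?_)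
  · rw [norm_mul, norm_mul, hn, hn]; simp
  · refine (intervalIntegral.norm_integral_le_integral_norm hle).trans (le_of_eq ?_)
    congr 1; ext u
    rw [norm_mul, hn]; simp

lemma osc_main (x : ℝ) : ∫ u in (-(π/2))..(π/2),
      ((Real.cos (u/2) : ℝ) : ℂ) * Complex.exp (x * Real.cos u * Complex.I) =
      (√2 * 2 * Complex.exp (x * Complex.I)) * ∫ v in (0:ℝ)..1, Complex.exp (-(x * Complex.I) * (v:ℂ)^2) := by
  have hd : ∀ u ∈ Set.uIcc (-(π/2)) (π/2), HasDerivAt (fun u : ℝ => √2 * Real.sin (u/2))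
      (√2 / 2 * Real.cos (u/2)) u := by
    intro u _
    refine ((((hasDerivAt_id u).div_const 2).sin).const_mul (√2)).congr_deriv ?_
    simp only [id]; ring
  have h := intervalIntegral.integral_deriv_smul_deriv_comp (a := -(π/2)) (b := π/2) (f := fun u : ℝ => √2 * Real.sin (u/2))
    (f' := fun u => √2 / 2 * Real.cos (u/2)) (g := fun w : ℝ => ∫ v in (0:ℝ)..w, Complex.exp (-(x * Complex.I) * (v:ℂ)^2))
    (g' := fun v : ℝ => Complex.exp (-(x * Complex.I) * (v:ℂ)^2)) hd
    (fun u _ => (Continuous.integral_hasStrictDerivAt (by fun_prop) _ _).hasDerivAt)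
    (Continuous.continuousOn (by fun_prop)) (by fun_prop)
  have s4 : Real.sin (π/2/2) = √2/2 := by rw [show π/2/2 = π/4 by ring, Real.sin_pi_div_four]
  have s22 : √2 * √2 = 2 := Real.mul_self_sqrt (by norm_num)
  have v1 : √2 * Real.sin (π/2/2) = 1 := by rw [s4]; linear_combination s22/2
  have v2 : √2 * Real.sin (-(π/2)/2) = -1 := by
    rw [neg_div, Real.sin_neg, s4]; linear_combination -s22/2
  simp only [Function.comp] at h
  rw [v1, v2] at h
  have hneg : ∫ v in (0:ℝ)..(-1), Complex.exp (-(x * Complex.I) * (v:ℂ)^2) =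
      - ∫ v in (0:ℝ)..1, Complex.exp (-(x * Complex.I) * (v:ℂ)^2) := by
    rw [intervalIntegral.integral_symm]
    have := intervalIntegral.integral_comp_neg (a := 0) (b := 1) (fun v : ℝ => Complex.exp (-(x * Complex.I) * (v:ℂ)^2))
    simp only [neg_zero] at this
    rw [← this]
    simp
  rw [hneg] at h
  rw [mul_assoc, mul_assoc, show ∀ z : ℂ, (2:ℂ) * (Complex.exp (x * Complex.I) * z) = Complex.exp (x * Complex.I) * (z - -z) by intro z; ring,
    ← h, ← intervalIntegral.integral_const_mul, ← intervalIntegral.integral_const_mul]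
  congr 1; ext u
  have hc : Real.cos u = 1 - (√2 * Real.sin (u/2))^2 := by
    have h1 := Real.cos_sq_add_sin_sq (u/2)
    have h2 : Real.cos u = 2 * Real.cos (u/2)^2 - 1 := by rw [← Real.cos_two_mul]; ring_nf
    rw [h2]; linear_combination 2 * h1 + Real.sin (u/2)^2 * s22
  rw [hc, Complex.real_smul]
  have : (x * ((1 - (√2 * Real.sin (u/2))^2 : ℝ)) * Complex.I : ℂ) = x * Complex.I +
      (-(x * Complex.I) * ((√2 * Real.sin (u/2) : ℝ) : ℂ)^2) := by push_cast; ring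
  rw [this, Complex.exp_add]
  have s22' : (√2 : ℂ) * √2 = 2 := by exact_mod_cast s22
  push_cast
  generalize Complex.exp (x * Complex.I) = p
  generalize Complex.exp _ = q
  linear_combination (-Complex.cos (u/2) * p * q / 2) * s22'

lemma osc_asymp (g h h' : ℝ → ℝ)
    (hg : ∀ u ∈ Set.uIcc (-(π/2)) (π/2), g u = Real.cos (u/2) + Real.sin u * h u)
    (hd : ∀ u ∈ Set.uIcc (-(π/2)) (π/2), HasDerivAt h (h' u) u)
    (hc : ContinuousOn h' (Set.uIcc (-(π/2)) (π/2))) :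
    Filter.Tendsto (fun x : ℝ => (√x : ℂ) * (∫ u in (-(π/2))..(π/2),
      (g u : ℂ) * Complex.exp (x * Real.cos u * Complex.I)) -
      √2 * √π * Complex.exp ((x - π/4 : ℝ) * Complex.I)) Filter.atTop (nhds 0) := by
  obtain ⟨K, hK⟩ := osc_parts h h' hd hc
  have hlim : Filter.Tendsto (fun x : ℝ => (√2 * 2 + K) * (√x)⁻¹) Filter.atTop (nhds 0) := by
    simpa using ((tendsto_inv_atTop_zero.comp Real.tendsto_sqrt_atTop).const_mul (√2 * 2 + K))
  refine squeeze_zero_norm' ?_ hlim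
  filter_upwards [Filter.eventually_gt_atTop 0] with x hx
  have hs : 0 < √x := Real.sqrt_pos.2 hx
  have hsx : √x * √x = x := Real.mul_self_sqrt hx.le
  have hch : ContinuousOn h (Set.uIcc (-(π/2)) (π/2)) := fun u hu => (hd u hu).continuousAt.continuousWithinAt
  have e : ∫ u in (-(π/2))..(π/2), (g u : ℂ) * Complex.exp (x * Real.cos u * Complex.I) =
      (∫ u in (-(π/2))..(π/2), ((Real.cos (u/2) : ℝ) : ℂ) * Complex.exp (x * Real.cos u * Complex.I)) +
      ∫ u in (-(π/2))..(π/2), ((Real.sin u * h u : ℝ) : ℂ) * Complex.exp (x * Real.cos u * Complex.I) := by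
    rw [← intervalIntegral.integral_add]
    · apply intervalIntegral.integral_congr
      intro u hu
      simp only
      rw [hg u hu]; push_cast; ring
    · exact Continuous.intervalIntegrable (by fun_prop) _ _
    · apply ContinuousOn.intervalIntegrable
      refine ContinuousOn.mul (Complex.continuous_ofReal.comp_continuousOn
        (Real.continuous_sin.continuousOn.mul hch)) (Continuous.continuousOn (by fun_prop))
  rw [e, osc_main]
  have hF := fresnel x hx
  have hP := hK x hx
  set F := ∫ v in (0:ℝ)..1, Complex.exp (-(x * Complex.I) * (v:ℂ)^2)
  set P := ∫ u in (-(π/2))..(π/2), ((Real.sin u * h u : ℝ) : ℂ) * Complex.exp (x * Real.cos u * Complex.I)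
  have hsc : (√x : ℂ) ≠ 0 := by exact_mod_cast hs.ne'
  have e2 : (√x : ℂ) * (√2 * 2 * Complex.exp (x * Complex.I) * F + P) -
      √2 * √π * Complex.exp ((x - π/4 : ℝ) * Complex.I) =
      (√x * √2 * 2 * Complex.exp (x * Complex.I)) * (F - (√π / 2 * Complex.exp (-(π/4) * Complex.I)) / √x)
      + √x * P := by
    rw [show (((x - π/4 : ℝ) : ℂ) * Complex.I) = x * Complex.I + (-(π/4) * Complex.I) by push_cast; ring,
      Complex.exp_add]
    field_simp
    ring
  rw [e2]
  refine (norm_add_le _ _).trans ?_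
  rw [norm_mul, norm_mul _ P, norm_mul, norm_mul, norm_mul, Complex.norm_exp_ofReal_mul_I,
    Complex.norm_real, Complex.norm_real, Real.norm_of_nonneg hs.le, Real.norm_of_nonneg (Real.sqrt_nonneg 2)]
  simp only [Complex.norm_ofNat, mul_one]
  calc _ ≤ √x * √2 * 2 * (1/x) + √x * (K/x) := by gcongr
    _ = _ := by
      have : 1/x = (√x)⁻¹ * (√x)⁻¹ := by rw [← mul_inv, hsx, one_div]
      rw [div_eq_mul_one_div K, this]; field_simp
noncomputable def hA (u : ℝ) : ℝ := Real.sin (u/4) / (2 * Real.cos (u/4) * Real.cos (u/2))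
noncomputable def hB (u : ℝ) : ℝ := Real.sin (u/2) / Real.cos (u/2)

lemma osc_range {u : ℝ} (hu : u ∈ Set.uIcc (-(π/2)) (π/2)) :
    0 < Real.cos (u/4) ∧ 0 < Real.cos (u/2) := by
  rw [Set.uIcc_of_le (by linarith [Real.pi_pos])] at hu
  have := Real.pi_pos
  exact ⟨Real.cos_pos_of_mem_Ioo ⟨by linarith [hu.1], by linarith [hu.2]⟩,
    Real.cos_pos_of_mem_Ioo ⟨by linarith [hu.1], by linarith [hu.2]⟩⟩

lemma hA_ne {u : ℝ} (hu : u ∈ Set.uIcc (-(π/2)) (π/2)) :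
    2 * Real.cos (u/4) * Real.cos (u/2) ≠ 0 := by
  have := osc_range hu
  have h1 := this.1; have h2 := this.2
  positivity

noncomputable def hA' (u : ℝ) : ℝ := ((1/4 * Real.cos (u/4)) * (2 * Real.cos (u/4) * Real.cos (u/2)) -
  Real.sin (u/4) * (2 * (-(1/4) * Real.sin (u/4)) * Real.cos (u/2) + 2 * Real.cos (u/4) * (-(1/2) * Real.sin (u/2))))
  / (2 * Real.cos (u/4) * Real.cos (u/2))^2
noncomputable def hB' (u : ℝ) : ℝ := ((1/2 * Real.cos (u/2)) * Real.cos (u/2) -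
  Real.sin (u/2) * (-(1/2) * Real.sin (u/2))) / (Real.cos (u/2))^2

lemma hA_deriv {u : ℝ} (hu : u ∈ Set.uIcc (-(π/2)) (π/2)) : HasDerivAt hA (hA' u) u := by
  have d4 := (hasDerivAt_id u).div_const 4
  have d2 := (hasDerivAt_id u).div_const 2
  refine (d4.sin.div ((d4.cos.const_mul 2).mul d2.cos) (hA_ne hu)).congr_deriv ?_
  simp only [hA', id, Pi.mul_apply]
  congr 1
  ring

lemma hB_deriv {u : ℝ} (hu : u ∈ Set.uIcc (-(π/2)) (π/2)) : HasDerivAt hB (hB' u) u := by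
  have d2 := (hasDerivAt_id u).div_const 2
  refine (d2.sin.div d2.cos (osc_range hu).2.ne').congr_deriv ?_
  simp only [hB', id]
  congr 1
  ring

lemma hA_cont : ContinuousOn hA' (Set.uIcc (-(π/2)) (π/2)) := by
  unfold hA'
  refine ContinuousOn.div (by fun_prop) (by fun_prop) (fun u hu => pow_ne_zero 2 (hA_ne hu))

lemma hB_cont : ContinuousOn hB' (Set.uIcc (-(π/2)) (π/2)) := by
  unfold hB'
  refine ContinuousOn.div (by fun_prop) (by fun_prop) (fun u hu => pow_ne_zero 2 (osc_range hu).2.ne')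

lemma hA_eq {u : ℝ} (hu : u ∈ Set.uIcc (-(π/2)) (π/2)) :
    (1:ℝ) = Real.cos (u/2) + Real.sin u * hA u := by
  have h := osc_range hu
  have h1 := h.1; have h2 := h.2
  have e1 : Real.sin u = 2 * Real.sin (u/2) * Real.cos (u/2) := by rw [← Real.sin_two_mul]; ring_nf
  have e2 : Real.sin (u/2) = 2 * Real.sin (u/4) * Real.cos (u/4) := by rw [← Real.sin_two_mul]; ring_nf
  have e3 : Real.cos (u/2) = 1 - 2 * Real.sin (u/4) ^ 2 := by
    rw [← Real.cos_two_mul_eq_one_sub]; ring_nf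
  have : Real.sin u * hA u = 2 * Real.sin (u/4)^2 := by
    unfold hA
    rw [e1, e2]; field_simp
  rw [this, e3]; ring

lemma hB_eq {u : ℝ} (hu : u ∈ Set.uIcc (-(π/2)) (π/2)) :
    Real.cos u = Real.cos (u/2) + Real.sin u * (hA u - hB u) := by
  have h := osc_range hu
  have h2 := h.2
  have e1 : Real.sin u = 2 * Real.sin (u/2) * Real.cos (u/2) := by rw [← Real.sin_two_mul]; ring_nf
  have e3 : Real.cos u = 1 - 2 * Real.sin (u/2) ^ 2 := by
    rw [← Real.cos_two_mul_eq_one_sub]; ring_nf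
  have : Real.sin u * hB u = 2 * Real.sin (u/2)^2 := by
    unfold hB
    rw [e1]; field_simp
  rw [mul_sub, this, e3]; linear_combination hA_eq hu

lemma osc_int_c (g : ℝ → ℝ) (hg : Continuous g) (x : ℝ) : (∫ u in (-(π/2))..(π/2),
      (g u : ℂ) * Complex.exp (x * Real.cos u * Complex.I)) = 
      ((∫ u in (-(π/2))..(π/2), g u * Real.cos (x * Real.cos u) : ℝ) : ℂ) +
      ((∫ u in (-(π/2))..(π/2), g u * Real.sin (x * Real.cos u) : ℝ) : ℂ) * Complex.I := by
  rw [← intervalIntegral.integral_ofReal, ← intervalIntegral.integral_ofReal,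
    ← intervalIntegral.integral_mul_const, ← intervalIntegral.integral_add]
  · congr 1; ext u
    rw [show (x * Real.cos u * Complex.I : ℂ) = ((x * Real.cos u : ℝ) : ℂ) * Complex.I by push_cast; ring,
      Complex.exp_mul_I]
    push_cast; ring
  all_goals exact Continuous.intervalIntegrable (by fun_prop) _ _

noncomputable def bA : ℝ := √2 * √π / π

lemma bA_pos : 0 < bA := by unfold bA; positivity

lemma bj_asymp0 : Filter.Tendsto (fun x : ℝ => √x * besselJ 0 x - bA * Real.cos (x - π/4))
    Filter.atTop (nhds 0) := by
  have h := osc_asymp (fun _ => 1) hA hA' (fun u hu => hA_eq hu)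
    (fun u hu => hA_deriv hu) hA_cont
  have h2 := ((Complex.continuous_re.tendsto 0).comp h).const_mul (1/π)
  simp only [Complex.zero_re, mul_zero] at h2
  refine h2.congr fun x => ?_
  simp only [Function.comp]
  rw [osc_int_c (fun _ => 1) continuous_const, Complex.exp_mul_I]
  have e : besselJ 0 x = (1/π) * ∫ u in (-(π/2))..(π/2), 1 * Real.cos (x * Real.cos u) := by
    unfold besselJ
    congr 1
    have := intervalIntegral.integral_comp_add_right (a := -(π/2)) (b := π/2) (fun t => Real.cos (x * Real.sin t)) (π/2)
    rw [show -(π/2)+π/2 = 0 by ring, show π/2+π/2=π by ring] at this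
    simp only [Real.sin_add_pi_div_two] at this
    simp [this]
  rw [e, ← Complex.ofReal_cos, ← Complex.ofReal_sin]
  generalize x - π/4 = y
  generalize (∫ u in (-(π/2))..(π/2), _ * Real.cos (x * Real.cos u)) = I1
  generalize (∫ u in (-(π/2))..(π/2), _ * Real.sin (x * Real.cos u)) = I2
  simp [bA, -Complex.ofReal_cos, -Complex.ofReal_sin]
  ring

lemma bj_asymp1 : Filter.Tendsto (fun x : ℝ => √x * besselJ 1 x - bA * Real.sin (x - π/4))
    Filter.atTop (nhds 0) := by
  have h := osc_asymp Real.cos (fun u => hA u - hB u) (fun u => hA' u - hB' u) (fun u hu => hB_eq hu)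
    (fun u hu => (hA_deriv hu).sub (hB_deriv hu)) (hA_cont.sub hB_cont)
  have h2 := ((Complex.continuous_im.tendsto 0).comp h).const_mul (1/π)
  simp only [Complex.zero_im, mul_zero] at h2
  refine h2.congr' ?_
  filter_upwards [Filter.eventually_gt_atTop 0] with x hx
  simp only [Function.comp]
  rw [osc_int_c Real.cos Real.continuous_cos, Complex.exp_mul_I]
  have e : besselJ 1 x = (1/π) * ∫ u in (-(π/2))..(π/2), Real.cos u * Real.sin (x * Real.cos u) := by
    have h1 := bj_d1 0 x
    rw [(bj_deriv0 0 x).deriv] at h1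
    have h3 : besselJ 1 x = - ((1 / π) * ∫ t in (0:ℝ)..π, -(Real.sin t * Real.sin (x * Real.sin t - (0:ℕ) * t))) := by
      apply mul_left_cancel₀ hx.ne'
      simp only [zero_add] at h1
      push_cast at h1 ⊢
      linear_combination h1
    rw [h3, intervalIntegral.integral_neg]
    have := intervalIntegral.integral_comp_add_right (a := -(π/2)) (b := π/2) (fun t => Real.sin t * Real.sin (x * Real.sin t)) (π/2)
    rw [show -(π/2)+π/2 = 0 by ring, show π/2+π/2=π by ring] at this
    simp only [Real.sin_add_pi_div_two] at this
    simp [this]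
  rw [e, ← Complex.ofReal_cos, ← Complex.ofReal_sin]
  generalize x - π/4 = y
  generalize (∫ u in (-(π/2))..(π/2), _ * Real.cos (x * Real.cos u)) = I1
  generalize (∫ u in (-(π/2))..(π/2), _ * Real.sin (x * Real.cos u)) = I2
  simp [bA, -Complex.ofReal_cos, -Complex.ofReal_sin]
  ring

lemma bj_asymp (n : ℕ) : Filter.Tendsto (fun x : ℝ => √x * besselJ n x - bA * Real.cos (x - (n*(π/2) + π/4)))
    Filter.atTop (nhds 0) := by
  have hstep : ∀ m : ℕ, ∀ x : ℝ, 0 < x → besselJ (m+2) x = 2*(m+1)/x * besselJ (m+1) x - besselJ m x := by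
    intro m x hx
    have h1 := bj_d1 (m+1) x
    have h2 := bj_d2 m x
    field_simp
    push_cast at h1
    linear_combination h1 - h2
  induction n using Nat.strong_induction_on with
  | _ n ih =>
    match n, ih with
    | 0, _ => simpa using bj_asymp0
    | 1, _ =>
      refine bj_asymp1.congr fun x => ?_
      rw [show x - ((1:ℕ) * (π/2) + π/4) = (x - π/4) - π/2 by push_cast; ring, Real.cos_sub_pi_div_two]
    | m+2, ih =>
      have i0 := ih m (by omega)
      have i1 := ih (m+1) (by omega)
      have hinv : Filter.Tendsto (fun x : ℝ => 2*((m:ℝ)+1) * x⁻¹) Filter.atTop (nhds 0) := by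
        simpa using tendsto_inv_atTop_zero.const_mul (2*((m:ℝ)+1))
      have hb : Filter.Tendsto (fun x : ℝ => (2*((m:ℝ)+1) * x⁻¹) * (bA * Real.cos (x - ((m+1:ℕ)*(π/2) + π/4)))) Filter.atTop (nhds 0) := by
        refine squeeze_zero_norm' (a := fun x => ‖2*((m:ℝ)+1) * x⁻¹‖ * bA) ?_ (by simpa using hinv.norm.mul_const bA)
        refine Filter.Eventually.of_forall fun x => ?_
        rw [norm_mul _ (bA * _), norm_mul bA, Real.norm_of_nonneg bA_pos.le]
        have := Real.abs_cos_le_one (x - ((m+1:ℕ)*(π/2) + π/4))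
        rw [← Real.norm_eq_abs] at this
        gcongr
        nlinarith [bA_pos]
      have := ((hinv.mul i1).add hb).sub i0
      simp only [mul_zero, add_zero, sub_zero] at this
      refine this.congr' ?_
      filter_upwards [Filter.eventually_gt_atTop 0] with x hx
      rw [hstep m x hx, show x - ((m+2:ℕ)*(π/2) + π/4) = (x - (m*(π/2)+π/4)) - π by push_cast; ring, Real.cos_sub_pi]
      field_simp
      ring

lemma bj_asympV (n : ℕ) : Filter.Tendsto (fun x : ℝ => (x * deriv (besselJ n) x) / √x + bA * Real.sin (x - (n*(π/2) + π/4)))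
    Filter.atTop (nhds 0) := by
  have i0 := bj_asymp n
  have i1 := bj_asymp (n+1)
  have hinv : Filter.Tendsto (fun x : ℝ => (n:ℝ) * x⁻¹) Filter.atTop (nhds 0) := by
    simpa using tendsto_inv_atTop_zero.const_mul (n:ℝ)
  have hb : Filter.Tendsto (fun x : ℝ => ((n:ℝ) * x⁻¹) * (bA * Real.cos (x - (n*(π/2) + π/4)))) Filter.atTop (nhds 0) := by
    refine squeeze_zero_norm' (a := fun x => ‖(n:ℝ) * x⁻¹‖ * bA) ?_ (by simpa using hinv.norm.mul_const bA)
    refine Filter.Eventually.of_forall fun x => ?_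
    rw [norm_mul _ (bA * _), norm_mul bA, Real.norm_of_nonneg bA_pos.le]
    have := Real.abs_cos_le_one (x - (n*(π/2) + π/4))
    rw [← Real.norm_eq_abs] at this
    gcongr
    nlinarith [bA_pos]
  have := ((hinv.mul i0).add hb).sub i1
  simp only [mul_zero, add_zero, sub_zero] at this
  refine this.congr' ?_
  filter_upwards [Filter.eventually_gt_atTop 0] with x hx
  have hs : 0 < √x := Real.sqrt_pos.2 hx
  have hsx : √x * √x = x := Real.mul_self_sqrt hx.le
  have hd := bj_d1 n x
  rw [hd, show x - ((n+1:ℕ)*(π/2) + π/4) = (x - (n*(π/2)+π/4)) - π/2 by push_cast; ring, Real.cos_sub_pi_div_two]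
  have : x⁻¹ = (√x)⁻¹ * (√x)⁻¹ := by rw [← mul_inv, hsx]
  rw [this, sub_div]
  have e2 : x * besselJ (n+1) x / √x = √x * besselJ (n+1) x := by
    nth_rewrite 1 [← hsx]; field_simp
  rw [e2]
  field_simp
  ring
lemma lift_exists (y0 x0 : ℝ) (h0 : y0 < x0) (a b a' b' : ℝ → ℝ)
    (ha : ∀ x, y0 < x → HasDerivAt a (a' x) x) (hb : ∀ x, y0 < x → HasDerivAt b (b' x) x)
    (ca : ContinuousOn a' (Set.Ioi y0)) (cb : ContinuousOn b' (Set.Ioi y0))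
    (hN : ∀ x, y0 < x → 0 < a x ^ 2 + b x ^ 2) (p r0 : ℝ) (hr0 : 0 < r0)
    (hpa : a x0 = r0 * Real.cos p) (hpb : b x0 = r0 * Real.sin p) :
    ∃ ψ : ℝ → ℝ, ψ x0 = p ∧
      (∀ x, y0 < x → HasDerivAt ψ ((a x * b' x - b x * a' x) / (a x ^ 2 + b x ^ 2)) x) ∧
      ∀ x, y0 < x → ∃ r, 0 < r ∧ a x = r * Real.cos (ψ x) ∧ b x = r * Real.sin (ψ x) := by
  have caa : ContinuousOn a (Set.Ioi y0) := fun x hx => (ha x hx).continuousAt.continuousWithinAt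
  have cbb : ContinuousOn b (Set.Ioi y0) := fun x hx => (hb x hx).continuousAt.continuousWithinAt
  obtain ⟨f, hf⟩ : ∃ f : ℝ → ℝ, ∀ x, f x = (a x * b' x - b x * a' x) / (a x ^ 2 + b x ^ 2) := ⟨_, fun _ => rfl⟩
  have cf : ContinuousOn f (Set.Ioi y0) :=
    ContinuousOn.congr (((caa.mul cb).sub (cbb.mul ca)).div ((caa.pow 2).add (cbb.pow 2)) (fun x hx => (hN x hx).ne')) (fun x _ => hf x)
  have hd : ∀ x, y0 < x → HasDerivAt (fun x => p + ∫ t in x0..x, f t) (f x) x := by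
    intro x hx
    apply HasDerivAt.const_add
    apply intervalIntegral.integral_hasDerivAt_right
    · apply ContinuousOn.intervalIntegrable
      apply cf.mono
      intro t ht
      rw [Set.mem_uIcc] at ht
      simp only [Set.mem_Ioi]
      rcases ht with ht | ht <;> linarith [ht.1]
    · exact cf.stronglyMeasurableAtFilter isOpen_Ioi x hx
    · exact cf.continuousAt (Ioi_mem_nhds hx)
  obtain ⟨ψ, hψ0, hd⟩ : ∃ ψ : ℝ → ℝ, ψ x0 = p ∧ ∀ x, y0 < x → HasDerivAt ψ (f x) x :=
    ⟨_, by simp, hd⟩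
  refine ⟨ψ, hψ0, fun x hx => hf x ▸ hd x hx, ?_⟩
  -- constants
  obtain ⟨N, hNd⟩ : ∃ N : ℝ → ℝ, ∀ x, N x = a x ^ 2 + b x ^ 2 := ⟨_, fun _ => rfl⟩
  have hNf : N = fun x => a x ^ 2 + b x ^ 2 := funext hNd
  replace hN : ∀ x, y0 < x → 0 < N x := fun x hx => by rw [hNd]; exact hN x hx
  have dN : ∀ x, y0 < x → HasDerivAt N (2 * (a x * a' x + b x * b' x)) x := by
    intro x hx
    rw [hNf]
    refine (((ha x hx).pow 2).add ((hb x hx).pow 2)).congr_deriv ?_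
    simp; ring
  have dS : ∀ x, y0 < x → HasDerivAt (fun x => √(N x)) ((a x * a' x + b x * b' x) / √(N x)) x := by
    intro x hx
    refine ((dN x hx).sqrt (hN x hx).ne').congr_deriv ?_
    have := Real.sqrt_pos.2 (hN x hx)
    field_simp
  have hC : ∀ x, y0 < x → HasDerivAt
      (fun x => (a x * Real.cos (ψ x) + b x * Real.sin (ψ x)) / √(N x)) 0 x := by
    intro x hx
    have hs := Real.sqrt_pos.2 (hN x hx)
    refine ((((ha x hx).mul (hd x hx).cos).add ((hb x hx).mul (hd x hx).sin)).div (dS x hx)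
      hs.ne').congr_deriv ?_
    rw [div_eq_zero_iff]; left
    have hsq : √(N x) * √(N x) = N x := Real.mul_self_sqrt (hN x hx).le
    have hNx := hN x hx
    have hfx : f x * N x = a x * b' x - b x * a' x := by
      rw [hf, ← hNd]; field_simp
    have hNe : N x = a x ^ 2 + b x ^ 2 := hNd x
    simp only [Pi.mul_apply, Pi.add_apply]
    field_simp
    rw [show √(N x) ^ 2 = N x by rw [sq, hsq]]
    linear_combination (-a x * Real.sin (ψ x) + b x * Real.cos (ψ x)) * hfx + (a' x * Real.cos (ψ x) + b' x * Real.sin (ψ x)) * hNe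
  have hD : ∀ x, y0 < x → HasDerivAt
      (fun x => (a x * Real.sin (ψ x) - b x * Real.cos (ψ x)) / √(N x)) 0 x := by
    intro x hx
    have hs := Real.sqrt_pos.2 (hN x hx)
    refine ((((ha x hx).mul (hd x hx).sin).sub ((hb x hx).mul (hd x hx).cos)).div (dS x hx)
      hs.ne').congr_deriv ?_
    rw [div_eq_zero_iff]; left
    have hsq : √(N x) * √(N x) = N x := Real.mul_self_sqrt (hN x hx).le
    have hNx := hN x hx
    have hfx : f x * N x = a x * b' x - b x * a' x := by
      rw [hf, ← hNd]; field_simp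
    have hNe : N x = a x ^ 2 + b x ^ 2 := hNd x
    simp only [Pi.mul_apply, Pi.sub_apply]
    field_simp
    rw [show √(N x) ^ 2 = N x by rw [sq, hsq]]
    linear_combination (a x * Real.cos (ψ x) + b x * Real.sin (ψ x)) * hfx + (a' x * Real.sin (ψ x) - b' x * Real.cos (ψ x)) * hNe
  have cst : ∀ F : ℝ → ℝ, (∀ x, y0 < x → HasDerivAt F 0 x) → ∀ x, y0 < x → F x = F x0 := by
    intro F hF x hx
    exact (convex_Ioi y0).is_const_of_fderivWithin_eq_zero (𝕜 := ℝ)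
      (fun y hy => (hF y hy).differentiableAt.differentiableWithinAt)
      (fun y hy => by
        rw [fderivWithin_of_isOpen isOpen_Ioi hy]
        ext; simp [(hF y hy).deriv]) hx h0
  have hN0 : √(N x0) = r0 := by
    have : N x0 = r0 ^ 2 := by
      simp only [hNd, hpa, hpb]
      linear_combination r0 ^ 2 * Real.sin_sq_add_cos_sq p
    rw [this, Real.sqrt_sq hr0.le]
  intro x hx
  have hs := Real.sqrt_pos.2 (hN x hx)
  have e1 := cst _ hC x hx
  have e2 := cst _ hD x hx
  simp only [hψ0, hN0, hpa, hpb] at e1 e2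
  have e1' : a x * Real.cos (ψ x) + b x * Real.sin (ψ x) = √(N x) := by
    rw [div_eq_iff hs.ne'] at e1
    rw [e1]; field_simp; linear_combination Real.sin_sq_add_cos_sq p
  have e2' : a x * Real.sin (ψ x) - b x * Real.cos (ψ x) = 0 := by
    rw [div_eq_iff hs.ne'] at e2
    rw [e2]; ring
  have h1 := Real.sin_sq_add_cos_sq (ψ x)
  refine ⟨√(N x), hs, ?_, ?_⟩
  · rw [← e1']; linear_combination Real.sin (ψ x) * e2' - a x * h1
  · rw [← e1']; linear_combination -Real.cos (ψ x) * e2' - b x * h1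
noncomputable def bS (n x : ℝ) : ℝ := √(x^2 - n^2)
noncomputable def bT (n x : ℝ) : ℝ := bS n x - n * Real.arccos (n / x)
noncomputable def bE (n x : ℝ) : ℝ := 1 / (4 * bS n x) + 5 * n^2 / (12 * bS n x ^ 3)

lemma bS_pos {n x : ℝ} (hn : 0 < n) (hx : n < x) : 0 < bS n x :=
  Real.sqrt_pos.2 (by nlinarith)

lemma bS_sq {n x : ℝ} (hn : 0 < n) (hx : n ≤ x) : bS n x ^ 2 = x^2 - n^2 :=
  Real.sq_sqrt (by nlinarith)

lemma bS_deriv {n x : ℝ} (hn : 0 < n) (hx : n < x) : HasDerivAt (bS n) (x / bS n x) x := by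
  have h : x^2 - n^2 ≠ 0 := by nlinarith
  have hs := bS_pos hn hx
  refine ((((hasDerivAt_id x).pow 2).sub_const (n^2)).sqrt h).congr_deriv ?_
  simp only [id, Pi.pow_apply]
  change _ / (2 * bS n x) = _
  field_simp
  norm_num

lemma bS_cont (n : ℝ) : Continuous (bS n) := by unfold bS; fun_prop

lemma bS_le {n x : ℝ} (hn : 0 < n) (hx : n ≤ x) : bS n x ≤ x := by
  unfold bS
  rw [Real.sqrt_le_left (by linarith)]
  nlinarith

lemma bS_mono {n x y : ℝ} (hn : 0 < n) (hx : n ≤ x) (hxy : x ≤ y) : bS n x ≤ bS n y := by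
  unfold bS
  apply Real.sqrt_le_sqrt
  nlinarith

lemma bT_deriv {n x : ℝ} (hn : 0 < n) (hx : n < x) : HasDerivAt (bT n) (bS n x / x) x := by
  have hx0 : 0 < x := hn.trans hx
  have hs := bS_pos hn hx
  have hsq := bS_sq hn hx.le
  have hr : n / x < 1 := (div_lt_one hx0).2 hx
  have hr0 : 0 < n / x := by positivity
  have hd : HasDerivAt (fun x => n / x) (-n / x^2) x := by
    refine ((hasDerivAt_const x n).div (hasDerivAt_id x) hx0.ne').congr_deriv ?_
    simp
  have ha := (Real.hasDerivAt_arccos (by linarith : n/x ≠ -1) (by linarith)).comp x hd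
  refine ((bS_deriv hn hx).sub (ha.const_mul n)).congr_deriv ?_
  have e : √(1 - (n/x)^2) = bS n x / x := by
    rw [show 1 - (n/x)^2 = (bS n x / x)^2 by rw [div_pow, div_pow, hsq]; field_simp]
    exact Real.sqrt_sq (by positivity)
  rw [e]
  field_simp
  rw [hsq]

lemma bT_cont {n : ℝ} (hn : 0 < n) : ContinuousOn (bT n) (Set.Ici n) := by
  unfold bT
  refine (bS_cont n).continuousOn.sub (continuousOn_const.mul (Real.continuous_arccos.comp_continuousOn ?_))
  exact continuousOn_const.div continuousOn_id (fun x hx => (hn.trans_le hx).ne')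

lemma bT_self {n : ℝ} (hn : 0 < n) : bT n n = 0 := by
  simp [bT, bS, div_self hn.ne']

lemma bT_mono {n : ℝ} (hn : 0 < n) : StrictMonoOn (bT n) (Set.Ici n) := by
  apply strictMonoOn_of_deriv_pos (convex_Ici n) (bT_cont hn)
  intro x hx
  rw [interior_Ici] at hx
  rw [(bT_deriv hn hx).deriv]
  exact div_pos (bS_pos hn hx) (hn.trans hx)

lemma bT_le {n x : ℝ} (hn : 0 < n) (hx : n ≤ x) : bT n x ≤ bS n x ^ 3 / x^2 := by
  have hm : MonotoneOn (fun x => bS n x ^ 3 / x^2 - bT n x) (Set.Ici n) := by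
    have hd : ∀ x, n < x → HasDerivAt (fun x => bS n x ^ 3 / x^2 - bT n x)
        (2 * n^2 * bS n x / x^3) x := by
      intro x hx
      have hx0 : 0 < x := hn.trans hx
      have hs := bS_pos hn hx
      have hsq := bS_sq hn hx.le
      refine ((((bS_deriv hn hx).pow 3).div ((hasDerivAt_id x).pow 2) (by simpa using hx0.ne')).sub
        (bT_deriv hn hx)).congr_deriv ?_
      simp only [id, Pi.pow_apply]
      field_simp
      simp
      have : bS n x ^ 4 = (x^2-n^2)^2 := by rw [← hsq]; ring
      ring_nf
      rw [this, hsq]; ring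
    apply monotoneOn_of_deriv_nonneg (convex_Ici n)
    · refine ContinuousOn.sub (ContinuousOn.div ((bS_cont n).pow 3).continuousOn (by fun_prop) ?_) (bT_cont hn)
      intro x hx
      exact pow_ne_zero 2 (hn.trans_le hx).ne'
    · intro x hx
      rw [interior_Ici] at hx
      exact (hd x hx).differentiableAt.differentiableWithinAt
    · intro x hx
      rw [interior_Ici] at hx
      rw [(hd x hx).deriv]
      have := bS_pos hn hx
      have : 0 < x := hn.trans hx
      positivity
  have := hm (Set.mem_Ici.2 le_rfl) (Set.mem_Ici.2 hx) hx
  simp only [bT_self hn] at this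
  have h0 : bS n n = 0 := by simp [bS]
  rw [h0] at this
  simp at this
  linarith

lemma bT_incr {n x y : ℝ} (hn : 0 < n) (hx : n ≤ x) (hxy : x ≤ y) :
    (y - x) * (bS n x / x) ≤ bT n y - bT n x := by
  have hx0 : 0 < x := hn.trans_le hx
  have := (convex_Icc x y).mul_sub_le_image_sub_of_le_deriv (f := bT n) (C := bS n x / x)
    ((bT_cont hn).mono (fun z hz => hx.trans hz.1))
    (fun z hz => by
      rw [interior_Icc] at hz
      exact (bT_deriv hn (hx.trans_lt hz.1)).differentiableAt.differentiableWithinAt)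
    (fun z hz => by
      rw [interior_Icc] at hz
      have hz0 : 0 < z := hx0.trans hz.1
      rw [(bT_deriv hn (hx.trans_lt hz.1)).deriv, div_le_div_iff₀ hx0 hz0]
      have h1 : 0 ≤ bS n x := Real.sqrt_nonneg _
      have h2 : 0 ≤ bS n z := Real.sqrt_nonneg _
      have e1 := bS_sq hn hx
      have e2 := bS_sq hn (hx.trans hz.1.le)
      apply le_of_sq_le_sq _ (by positivity)
      rw [mul_pow, mul_pow, e1, e2]
      nlinarith [hz.1, mul_pos hx0 hz0, mul_pos hn hn, mul_self_lt_mul_self hx0.le hz.1])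
    x ⟨le_rfl, hxy⟩ y ⟨hxy, le_rfl⟩ hxy
  linarith

lemma bE_deriv {n x : ℝ} (hn : 0 < n) (hx : n < x) :
    HasDerivAt (bE n) (-(x * (x^2 + 4*n^2) / (4 * bS n x ^ 5))) x := by
  have hs := bS_pos hn hx
  have hsq := bS_sq hn hx.le
  have hd := bS_deriv hn hx
  refine (((hasDerivAt_const x (1:ℝ)).div (hd.const_mul 4) (by positivity)).add
    ((hasDerivAt_const x (5*n^2)).div ((hd.pow 3).const_mul 12) (by simp [hs.ne']))).congr_deriv ?_
  simp only [Pi.pow_apply]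
  have h4 : bS n x ^ 4 = (x^2-n^2)^2 := by rw [← hsq]; ring
  field_simp
  simp
  ring_nf
  simp only [h4, hsq]
  ring

lemma bS_tendsto (n : ℝ) : Filter.Tendsto (bS n) Filter.atTop Filter.atTop := by
  apply Real.tendsto_sqrt_atTop.comp
  exact Filter.tendsto_atTop_add_const_right _ _ (Filter.tendsto_pow_atTop (by norm_num))

lemma bE_tendsto (n : ℝ) : Filter.Tendsto (bE n) Filter.atTop (nhds 0) := by
  have h := tendsto_inv_atTop_zero.comp (bS_tendsto n)
  have := (h.const_mul (1/4)).add ((h.pow 3).const_mul (5*n^2/12))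
  simp at this
  refine this.congr fun x => ?_
  unfold bE
  simp [div_eq_mul_inv]
  ring

lemma bT_tendsto {n : ℝ} (hn : 0 < n) :
    Filter.Tendsto (fun x => x - n * (π/2) - bT n x) Filter.atTop (nhds 0) := by
  have h1 : Filter.Tendsto (fun x => x - bS n x) Filter.atTop (nhds 0) := by
    have hi : Filter.Tendsto (fun x : ℝ => n^2 * x⁻¹) Filter.atTop (nhds 0) := by
      simpa using tendsto_inv_atTop_zero.const_mul (n^2)
    refine squeeze_zero' ?_ ?_ hi
    · filter_upwards [Filter.eventually_ge_atTop n] with x hx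
      linarith [bS_le hn hx]
    · filter_upwards [Filter.eventually_ge_atTop n] with x hx
      have hx0 : 0 < x := hn.trans_le hx
      have h1 := bS_sq hn hx
      have h2 := bS_le hn hx
      have h0 : 0 ≤ bS n x := Real.sqrt_nonneg _
      rw [← div_eq_mul_inv, le_div_iff₀ hx0]
      nlinarith
  have h2 : Filter.Tendsto (fun x => n * Real.arccos (n / x)) Filter.atTop (nhds (n * (π/2))) := by
    apply Filter.Tendsto.const_mul
    rw [← Real.arccos_zero]
    apply (Real.continuous_arccos.tendsto 0).comp
    exact Filter.Tendsto.const_div_atTop Filter.tendsto_id n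
  have := (h1.add h2).sub_const (n*(π/2))
  rw [zero_add, sub_self] at this
  refine this.congr fun x => ?_
  unfold bT; ring

lemma nonvan {n : ℝ} {J V : ℝ → ℝ}
    (hJ : ∀ x, 0 < x → HasDerivAt J (V x / x) x)
    (hV : ∀ x, 0 < x → HasDerivAt V (-(x^2 - n^2)/x * J x) x)
    (x0 : ℝ) (hx0 : 0 < x0) (h0 : 0 < V x0 ^ 2 + J x0 ^ 2) (x : ℝ) (hx : 0 < x) :
    0 < V x ^ 2 + J x ^ 2 := by
  set G : ℝ → ℝ := fun x => (1+n^2) * Real.log x + x^2/2 with hG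
  have dG : ∀ x, 0 < x → HasDerivAt G ((1+n^2+x^2)/x) x := by
    intro x hx
    refine (((Real.hasDerivAt_log hx.ne').const_mul (1+n^2)).add
      (((hasDerivAt_id x).pow 2).div_const 2)).congr_deriv ?_
    simp only [id]
    field_simp
    simp
    ring
  have dN : ∀ x, 0 < x → HasDerivAt (fun x => V x ^ 2 + J x ^ 2)
      (2 * V x * J x * (1 + n^2 - x^2) / x) x := by
    intro x hx
    refine (((hV x hx).pow 2).add ((hJ x hx).pow 2)).congr_deriv ?_
    field_simp
    ring
  have key : ∀ x, 0 < x → ∀ s : ℝ, s = 1 ∨ s = -1 → 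
      0 ≤ s * (2 * V x * J x * (1 + n^2 - x^2) / x) + (V x ^ 2 + J x ^ 2) * ((1+n^2+x^2)/x) := by
    intro x hx s hs
    have : s * (2 * V x * J x * (1 + n^2 - x^2) / x) + (V x ^ 2 + J x ^ 2) * ((1+n^2+x^2)/x)
       = ((1+n^2) * (V x + s * J x)^2 + x^2 * (V x - s * J x)^2) / x := by
      rcases hs with rfl | rfl <;> field_simp <;> ring
    rw [this]; positivity
  have m1 : MonotoneOn (fun x => (V x ^ 2 + J x ^ 2) * Real.exp (G x)) (Set.Ioi 0) := by
    have hd : ∀ x, 0 < x → HasDerivAt (fun x => (V x ^ 2 + J x ^ 2) * Real.exp (G x)) _ x :=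
      fun x hx => (dN x hx).mul (dG x hx).exp
    apply monotoneOn_of_deriv_nonneg (convex_Ioi 0)
    · exact fun x hx => (hd x hx).continuousAt.continuousWithinAt
    · rw [interior_Ioi]
      exact fun x hx => (hd x hx).differentiableAt.differentiableWithinAt
    · rw [interior_Ioi]
      intro x hx
      rw [(hd x hx).deriv]
      have := mul_nonneg (key x hx 1 (Or.inl rfl)) (Real.exp_pos (G x)).le
      linarith
  have m2 : AntitoneOn (fun x => (V x ^ 2 + J x ^ 2) * Real.exp (-G x)) (Set.Ioi 0) := by
    have hd : ∀ x, 0 < x → HasDerivAt (fun x => (V x ^ 2 + J x ^ 2) * Real.exp (-G x)) _ x :=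
      fun x hx => (dN x hx).mul (dG x hx).neg.exp
    apply antitoneOn_of_deriv_nonpos (convex_Ioi 0)
    · exact fun x hx => (hd x hx).continuousAt.continuousWithinAt
    · rw [interior_Ioi]
      exact fun x hx => (hd x hx).differentiableAt.differentiableWithinAt
    · rw [interior_Ioi]
      intro x hx
      rw [(hd x hx).deriv]
      have := mul_nonneg (key x hx (-1) (Or.inr rfl)) (Real.exp_pos (-G x)).le
      simp only [Pi.neg_apply] at *
      linarith
  rcases le_total x0 x with h | h
  · have := m1 hx0 hx h
    simp only at this
    have h2 := mul_pos h0 (Real.exp_pos (G x0))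
    exact pos_of_mul_pos_left (h2.trans_le this) (Real.exp_pos _).le
  · have := m2 hx hx0 h
    simp only at this
    have h2 := mul_pos h0 (Real.exp_pos (-G x0))
    exact pos_of_mul_pos_left (h2.trans_le this) (Real.exp_pos _).le

lemma sign_small {n : ℝ} {J V : ℝ → ℝ} (hn : 0 < n)
    (hJ : ∀ x, 0 < x → HasDerivAt J (V x / x) x)
    (hV : ∀ x, 0 < x → HasDerivAt V (-(x^2 - n^2)/x * J x) x)
    (hN : ∀ x, 0 < x → 0 < V x ^ 2 + J x ^ 2)
    (hc : ContinuousWithinAt (fun x => J x * V x) (Set.Ici 0) 0) (h0 : J 0 * V 0 = 0)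
    (x : ℝ) (hx : 0 < x) (hxn : x ≤ n) : 0 < J x * V x := by
  have hd : ∀ x, 0 < x → HasDerivAt (fun x => J x * V x) ((V x^2 + (n^2-x^2) * J x^2)/x) x := by
    intro x hx
    refine ((hJ x hx).mul (hV x hx)).congr_deriv ?_
    field_simp
    ring
  have hs : StrictMonoOn (fun x => J x * V x) (Set.Icc 0 n) := by
    apply strictMonoOn_of_deriv_pos (convex_Icc 0 n)
    · intro y hy
      rcases hy.1.eq_or_lt with rfl | h
      · exact hc.mono Set.Icc_subset_Ici_self
      · exact (hd y h).continuousAt.continuousWithinAt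
    · rw [interior_Icc]
      intro y hy
      rw [(hd y hy.1).deriv]
      apply div_pos _ hy.1
      have h1 : 0 < n^2 - y^2 := by nlinarith [hy.1, hy.2]
      have h2 := hN y hy.1
      rcases eq_or_ne (J y) 0 with h | h
      · rw [h] at h2 ⊢; simpa using h2
      · positivity
  have := hs ⟨le_rfl, hn.le⟩ ⟨hx.le, hxn⟩ hx
  simp only at this
  linarith

structure BSys (n : ℝ) (J V : ℝ → ℝ) : Prop where
  hn : 1 ≤ n
  hJ : ∀ x, 0 < x → HasDerivAt J (V x / x) x
  hV : ∀ x, 0 < x → HasDerivAt V (-(x^2 - n^2)/x * J x) x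
  hN : ∀ x, 0 < x → 0 < V x ^ 2 + J x ^ 2
  Jn : 0 < J n
  Vn : 0 < V n
  asy : ∃ A : ℝ, A ≠ 0 ∧
    Filter.Tendsto (fun x => √x * J x - A * Real.cos (x - (n*(π/2) + π/4))) Filter.atTop (nhds 0) ∧
    Filter.Tendsto (fun x => V x / √x + A * Real.sin (x - (n*(π/2) + π/4))) Filter.atTop (nhds 0)

lemma polar (a b : ℝ) (hb : 0 < b) : ∃ p r : ℝ, 0 < r ∧ 0 < p ∧ p < π ∧ (0 < a → p < π/2) ∧
    a = r * Real.cos p ∧ b = r * Real.sin p := by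
  have h1 := Real.arctan_lt_pi_div_two (a/b)
  have h2 := Real.neg_pi_div_two_lt_arctan (a/b)
  have hs : 0 < √(1 + (a/b)^2) := Real.sqrt_pos.2 (by positivity)
  refine ⟨π/2 - Real.arctan (a/b), b * √(1 + (a/b)^2), by positivity, by linarith, by linarith,
    fun ha => ?_, ?_, ?_⟩
  · have : 0 < Real.arctan (a/b) := Real.arctan_pos.2 (by positivity)
    linarith
  · rw [Real.cos_pi_div_two_sub, Real.sin_arctan]
    field_simp
  · rw [Real.sin_pi_div_two_sub, Real.cos_arctan]
    field_simp

lemma chi_exists {n : ℝ} {J V : ℝ → ℝ} (B : BSys n J V) (q : ℝ) (hq : 1 ≤ q) (hq3 : q^3 = n^2) :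
    ∃ χ : ℝ → ℝ, 0 < χ n ∧ χ n < π/2 ∧ 
      (∀ x, 0 < x → ∃ r, 0 < r ∧ V x = r * Real.cos (χ x) ∧ q * J x = r * Real.sin (χ x)) ∧
      StrictMonoOn χ (Set.Ici n) ∧ ContinuousOn χ (Set.Ici n) ∧ χ (√(n^2+q^2)) < π := by
  have hn0 : 0 < n := by linarith [B.hn]
  have hq0 : 0 < q := by linarith
  obtain ⟨p, r0, hr0, hp0, hp1, hp2, ea, eb⟩ := polar (V n) (q * J n) (mul_pos hq0 B.Jn)
  have hp2 := hp2 B.Vn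
  have hd0 : ∀ x, 0 < x → V x ^ 2 + (q * J x)^2 > 0 := by
    intro x hx
    have h2 := B.hN x hx
    rcases eq_or_ne (J x) 0 with h | h
    · rw [h] at h2 ⊢; simpa using h2
    · positivity
  obtain ⟨χ, h1, h2, h3⟩ := lift_exists 0 n hn0 V (fun x => q * J x)
    (fun x => -(x^2 - n^2)/x * J x) (fun x => q * (V x / x)) B.hV
    (fun x hx => (B.hJ x hx).const_mul q)
    (by
      intro x hx
      have hx0 : x ≠ 0 := (ne_of_gt hx)
      have := (B.hJ x hx).continuousAt
      apply ContinuousAt.continuousWithinAt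
      fun_prop (disch := assumption))
    (by
      intro x hx
      have hx0 : x ≠ 0 := (ne_of_gt hx)
      have := (B.hV x hx).continuousAt
      apply ContinuousAt.continuousWithinAt
      fun_prop (disch := assumption))
    hd0 p r0 hr0 ea eb
  have hx1 : n < √(n^2+q^2) := by
    apply Real.lt_sqrt_of_sq_lt; nlinarith
  have h2' : ∀ x, 0 < x → HasDerivAt χ (q * (V x ^ 2 + (x^2-n^2) * J x^2) / (x * (V x ^ 2 + (q * J x)^2))) x := by
    intro x hx
    refine (h2 x hx).congr_deriv ?_
    have := (hd0 x hx).ne'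
    field_simp
    ring
  have hc : ContinuousOn χ (Set.Ici n) := fun x hx => 
    (h2 x (hn0.trans_le hx)).continuousAt.continuousWithinAt
  refine ⟨χ, by rwa [h1], by rwa [h1], h3, ?_, hc, ?_⟩
  · apply strictMonoOn_of_deriv_pos (convex_Ici n) hc
    intro x hx
    rw [interior_Ici] at hx
    have hx : n < x := hx
    have hx0 : 0 < x := hn0.trans hx
    rw [(h2' x hx0).deriv]
    have a1 := hd0 x hx0
    apply div_pos _ (by positivity)
    have a2 : 0 < x^2 - n^2 := by nlinarith
    have h2 := B.hN x hx0
    rcases eq_or_ne (J x) 0 with h | h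
    · rw [h] at h2 ⊢; simp at h2 ⊢; positivity
    · positivity
  · set x1 := √(n^2+q^2) with hx1d
    have hsq : x1^2 = n^2+q^2 := Real.sq_sqrt (by positivity)
    have := (convex_Icc n x1).image_sub_le_mul_sub_of_deriv_le (f := χ) (C := q/n)
      (hc.mono Set.Icc_subset_Ici_self)
      (fun z hz => by
        rw [interior_Icc] at hz
        exact (h2 z (hn0.trans hz.1)).differentiableAt.differentiableWithinAt)
      (fun z hz => by
        rw [interior_Icc] at hz
        have hz0 := hn0.trans hz.1
        rw [(h2' z hz0).deriv]
        have a1 := hd0 z hz0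
        have a2 : z^2 - n^2 ≤ q^2 := by nlinarith [hz.1, hz.2]
        rw [div_le_div_iff₀ (by positivity) hn0]
        have a3 : V z ^ 2 + (z^2-n^2) * J z^2 ≤ V z ^ 2 + (q * J z)^2 := by
          nlinarith [mul_le_mul_of_nonneg_right a2 (sq_nonneg (J z))]
        calc q * (V z ^ 2 + (z^2-n^2) * J z^2) * n ≤ q * (V z ^ 2 + (q * J z)^2) * n := by gcongr
          _ ≤ q * (V z ^ 2 + (q * J z)^2) * z := by
            have := hz.1.le
            gcongr
          _ = _ := by ring)
      n ⟨le_rfl, hx1.le⟩ x1 ⟨hx1.le, le_rfl⟩ hx1.le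
    have hb : q/n * (x1 - n) ≤ 1/2 := by
      have : x1 - n ≤ q^2/(2*n) := by
        rw [le_div_iff₀ (by positivity)]
        nlinarith
      calc q/n * (x1 - n) ≤ q/n * (q^2/(2*n)) := by gcongr
        _ = q^3/(2*n^2) := by field_simp
        _ = 1/2 := by rw [hq3]; field_simp
    have := Real.pi_gt_three
    linarith [h1 ▸ hp2]

lemma zero_mul_bdd {f g : ℝ → ℝ} (C : ℝ) (hf : Filter.Tendsto f Filter.atTop (nhds 0))
    (hg : ∀ᶠ x in Filter.atTop, |g x| ≤ C) :
    Filter.Tendsto (fun x => f x * g x) Filter.atTop (nhds 0) := by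
  have h1 : Filter.Tendsto (fun x => |f x| * C) Filter.atTop (nhds 0) := by
    simpa using hf.abs.mul_const C
  refine squeeze_zero_norm' ?_ h1
  filter_upwards [hg] with x hx
  rw [Real.norm_eq_abs, abs_mul]
  gcongr

/-- Limit of the phase is an odd multiple. -/
lemma phase_limit {n : ℝ} {J V : ℝ → ℝ} (B : BSys n J V) (ψ : ℝ → ℝ) (x1 : ℝ)
    (hψ : ∀ x, x1 ≤ x → ∃ r, 0 < r ∧ V x + x^2/(2 * bS n x^2) * J x = r * Real.cos (ψ x) ∧
      bS n x * J x = r * Real.sin (ψ x)) (l : ℝ)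
    (hl : Filter.Tendsto (fun x => ψ x - bT n x) Filter.atTop (nhds l)) :
    ∃ j : ℤ, l = π/4 + j * π := by
  have hn0 : 0 < n := by linarith [B.hn]
  obtain ⟨A, hA, h1, h2⟩ := B.asy
  set β := n*(π/2) + π/4 with hβ
  have hbd : ∀ᶠ x in Filter.atTop, |√x * J x| ≤ |A| + 1 := by
    have : ∀ᶠ x in Filter.atTop, |√x * J x - A * Real.cos (x - β)| < 1 := by
      have := h1.abs
      rw [abs_zero] at this
      exact this.eventually_lt_const one_pos
    filter_upwards [this] with x hx
    have h3 : |A * Real.cos (x - β)| ≤ |A| := by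
      rw [abs_mul]
      exact mul_le_of_le_one_right (abs_nonneg _) (Real.abs_cos_le_one _)
    calc |√x * J x| = |(√x * J x - A * Real.cos (x - β)) + A * Real.cos (x - β)| := by ring_nf
      _ ≤ _ := abs_add_le _ _
      _ ≤ _ := by linarith
  have hSx : Filter.Tendsto (fun x => bS n x / x - 1) Filter.atTop (nhds 0) := by
    have hi : Filter.Tendsto (fun x : ℝ => (n^2) * x⁻¹) Filter.atTop (nhds 0) := by
      simpa using tendsto_inv_atTop_zero.const_mul (n^2)
    refine squeeze_zero_norm' ?_ hi
    filter_upwards [Filter.eventually_ge_atTop n] with x hx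
    have hx0 : 0 < x := hn0.trans_le hx
    have hx1 : 1 ≤ x := B.hn.trans hx
    have h1 := bS_sq hn0 hx
    have h2 := bS_le hn0 hx
    have h0 : 0 ≤ bS n x := Real.sqrt_nonneg _
    rw [Real.norm_eq_abs, abs_sub_comm, abs_of_nonneg (by rw [sub_nonneg, div_le_one hx0]; exact h2),
      ← div_eq_mul_inv, le_div_iff₀ hx0, sub_mul, div_mul_cancel₀ _ hx0.ne']
    nlinarith
  have hS2 : Filter.Tendsto (fun x => x/(2*bS n x^2)) Filter.atTop (nhds 0) := by
    have hi : Filter.Tendsto (fun x : ℝ => x⁻¹) Filter.atTop (nhds 0) := tendsto_inv_atTop_zero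
    refine squeeze_zero' ?_ ?_ hi
    · filter_upwards [Filter.eventually_ge_atTop n] with x hx
      have hx0 : 0 < x := hn0.trans_le hx
      positivity
    · filter_upwards [Filter.eventually_ge_atTop (2*n)] with x hx
      have hx0 : 0 < x := by linarith
      have h1 := bS_sq hn0 (by linarith : n ≤ x)
      rw [h1, div_le_iff₀ (by nlinarith)]
      field_simp
      nlinarith
  -- e1
  have e1 : Filter.Tendsto (fun x => (V x + x^2/(2 * bS n x^2) * J x) / √x + A * Real.sin (x - β))
      Filter.atTop (nhds 0) := by
    have := h2.add (zero_mul_bdd _ hS2 hbd)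
    rw [zero_add] at this
    refine this.congr' ?_
    filter_upwards [Filter.eventually_gt_atTop n] with x hx
    have hx0 : 0 < x := hn0.trans hx
    have hs := bS_pos hn0 hx
    have hq : 0 < √x := Real.sqrt_pos.2 hx0
    have hq2 : √x ^ 2 = x := Real.sq_sqrt hx0.le
    field_simp
    linear_combination (x * J x) * hq2
  have e2 : Filter.Tendsto (fun x => (bS n x * J x) / √x - A * Real.cos (x - β))
      Filter.atTop (nhds 0) := by
    have := h1.add (zero_mul_bdd _ hSx hbd)
    rw [zero_add] at this
    refine this.congr' ?_
    filter_upwards [Filter.eventually_gt_atTop n] with x hx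
    have hx0 : 0 < x := hn0.trans hx
    have hs := bS_pos hn0 hx
    have hq : 0 < √x := Real.sqrt_pos.2 hx0
    have hq2 : √x ^ 2 = x := Real.sq_sqrt hx0.le
    field_simp
    linear_combination (bS n x * J x) * hq2
  set ε1 := fun x => (V x + x^2/(2 * bS n x^2) * J x) / √x + A * Real.sin (x - β) with hε1
  set ε2 := fun x => (bS n x * J x) / √x - A * Real.cos (x - β) with hε2
  have f1 : Filter.Tendsto (fun x => ε1 x * Real.cos (x-β) + ε2 x * Real.sin (x-β)) Filter.atTop (nhds 0) := by
    have := (zero_mul_bdd (g := fun x => Real.cos (x-β)) 1 e1 (Filter.Eventually.of_forall fun x => Real.abs_cos_le_one _)).add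
      (zero_mul_bdd (g := fun x => Real.sin (x-β)) 1 e2 (Filter.Eventually.of_forall fun x => Real.abs_sin_le_one _))
    simpa using this
  have f2 : Filter.Tendsto (fun x => (ε1 x * ε1 x + ε2 x * ε2 x) + 2 * A * (ε2 x * Real.cos (x-β) - ε1 x * Real.sin (x-β)) + A^2) Filter.atTop (nhds (A^2)) := by
    have := (zero_mul_bdd (g := fun x => Real.cos (x-β)) 1 e2 (Filter.Eventually.of_forall fun x => Real.abs_cos_le_one _)).sub
      (zero_mul_bdd (g := fun x => Real.sin (x-β)) 1 e1 (Filter.Eventually.of_forall fun x => Real.abs_sin_le_one _))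
    have := ((((e1.mul e1).add (e2.mul e2)).add (this.const_mul (2*A))).add_const (A^2))
    simpa using this
  have f3 := (f1.pow 2).div f2 (pow_ne_zero 2 hA)
  have f4 : Filter.Tendsto (fun x => Real.cos (x - β - ψ x)^2) Filter.atTop (nhds 0) := by
    rw [show (0:ℝ)^2 / A^2 = 0 by simp] at f3
    refine f3.congr' ?_
    filter_upwards [Filter.eventually_gt_atTop n, Filter.eventually_ge_atTop x1] with x hx hx1
    have hx0 : 0 < x := hn0.trans hx
    have hq : 0 < √x := Real.sqrt_pos.2 hx0
    obtain ⟨r, hr, ea, eb⟩ := hψ x hx1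
    have g1 : ε1 x = r / √x * Real.cos (ψ x) + A * Real.sin (x-β) := by
      simp only [hε1]; rw [ea]; ring
    have g2 : ε2 x = r / √x * Real.sin (ψ x) - A * Real.cos (x-β) := by
      simp only [hε2]; rw [eb]; ring
    have hR : 0 < r / √x := by positivity
    have n1 : ε1 x * Real.cos (x-β) + ε2 x * Real.sin (x-β) = r/√x * Real.cos (x-β-ψ x) := by
      rw [g1, g2, Real.cos_sub (x-β) (ψ x)]; ring
    have n2 : (ε1 x * ε1 x + ε2 x * ε2 x) + 2 * A * (ε2 x * Real.cos (x-β) - ε1 x * Real.sin (x-β)) + A^2 = (r/√x)^2 := by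
      rw [g1, g2]
      have s1 := Real.sin_sq_add_cos_sq (ψ x)
      have s2 := Real.sin_sq_add_cos_sq (x-β)
      linear_combination (r/√x)^2 * s1 - A^2 * s2
    simp only [Pi.div_apply, n1, n2]
    field_simp
  have f5 : Filter.Tendsto (fun x => Real.cos (x - β - ψ x)^2) Filter.atTop (nhds (Real.cos (0 - π/4 - l)^2)) := by
    have := (((bT_tendsto hn0).sub_const (π/4)).sub hl)
    refine (((Real.continuous_cos.pow 2).tendsto _).comp this).congr fun x => ?_
    simp only [Function.comp, Pi.pow_apply]
    congr 2
    rw [hβ]; ring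
  have h0 := tendsto_nhds_unique f5 f4
  have h0 := pow_eq_zero_iff (two_ne_zero) |>.1 h0
  rw [show 0 - π/4 - l = -(π/4 + l) by ring, Real.cos_neg, Real.cos_eq_zero_iff] at h0
  obtain ⟨j, hj⟩ := h0
  exact ⟨j, by linarith⟩

lemma psi_exists {n : ℝ} {J V : ℝ → ℝ} (B : BSys n J V) (q : ℝ) (hq : 1 ≤ q) (hq3 : q^3 = n^2)
    (x1 : ℝ) (hx1 : x1 = √(n^2+q^2)) (hJ1 : 0 < J x1) :
    ∃ ψ : ℝ → ℝ, 0 < ψ x1 ∧ ψ x1 < π ∧ ContinuousOn ψ (Set.Ici x1) ∧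
      (∀ x, x1 ≤ x → ∃ r, 0 < r ∧ V x + x^2/(2 * bS n x^2) * J x = r * Real.cos (ψ x) ∧
        bS n x * J x = r * Real.sin (ψ x)) ∧
      (∀ x, x1 ≤ x → ψ x ≤ bT n x + π/4) ∧ (∀ x, x1 ≤ x → bT n x + π/4 - bE n x ≤ ψ x) := by
  have hn0 : 0 < n := by linarith [B.hn]
  have hq0 : 0 < q := by linarith
  have hnx : n < x1 := by
    rw [hx1]; apply Real.lt_sqrt_of_sq_lt; nlinarith
  have hSx1 : bS n x1 = q := by
    rw [bS, hx1, Real.sq_sqrt (by positivity)]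
    rw [show n^2+q^2-n^2 = q^2 by ring, Real.sqrt_sq hq0.le]
  obtain ⟨p, r0, hr0, hp0, hp1, -, ea, eb⟩ := polar (V x1 + x1^2/(2 * bS n x1^2) * J x1)
    (bS n x1 * J x1) (by rw [hSx1]; positivity)
  set a : ℝ → ℝ := fun x => V x + x^2/(2 * bS n x^2) * J x with ha
  set b : ℝ → ℝ := fun x => bS n x * J x with hb
  have hda : ∀ x, n < x → HasDerivAt a
      (-(x^2 - n^2)/x * J x + (-(x * n^2 / bS n x^4)) * J x + x^2/(2 * bS n x^2) * (V x / x)) x := by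
    intro x hx
    have hx0 := hn0.trans hx
    have hs := bS_pos hn0 hx
    have hsq := bS_sq hn0 hx.le
    have h1 : HasDerivAt (fun x => x^2/(2 * bS n x^2)) (-(x * n^2 / bS n x^4)) x := by
      refine (((hasDerivAt_id x).pow 2).div (((bS_deriv hn0 hx).pow 2).const_mul 2)
        (by simp [hs.ne'])).congr_deriv ?_
      simp only [id, Pi.pow_apply]
      field_simp
      simp
      linear_combination 2 * x * bS n x * hsq
    refine ((B.hV x hx0).add (h1.mul (B.hJ x hx0))).congr_deriv ?_
    ring
  have hdb : ∀ x, n < x → HasDerivAt b (x / bS n x * J x + bS n x * (V x / x)) x := by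
    intro x hx
    have hx0 := hn0.trans hx
    exact (bS_deriv hn0 hx).mul (B.hJ x hx0)
  have hpos : ∀ x, n < x → 0 < a x^2 + b x^2 := by
    intro x hx
    have hx0 := hn0.trans hx
    have hs := bS_pos hn0 hx
    have h2 := B.hN x hx0
    simp only [ha, hb]
    rcases eq_or_ne (J x) 0 with h | h
    · rw [h] at h2 ⊢; simpa using h2
    · positivity
  obtain ⟨ψ, h1, h2, h3⟩ := lift_exists n x1 hnx a b _ _ hda hdb
    (by
      intro x hx
      have hx0 : x ≠ 0 := (hn0.trans hx).ne'
      have c1 := (B.hJ x (hn0.trans hx)).continuousAt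
      have c2 := (B.hV x (hn0.trans hx)).continuousAt
      have c3 := (bS_cont n).continuousAt (x := x)
      have hs := (bS_pos hn0 hx).ne'
      have hs2 : 2 * bS n x^2 ≠ 0 := by positivity
      have hs4 : bS n x^4 ≠ 0 := by positivity
      apply ContinuousAt.continuousWithinAt
      fun_prop (disch := assumption))
    (by
      intro x hx
      have hx0 : x ≠ 0 := (hn0.trans hx).ne'
      have c1 := (B.hJ x (hn0.trans hx)).continuousAt
      have c2 := (B.hV x (hn0.trans hx)).continuousAt
      have c3 := (bS_cont n).continuousAt (x := x)
      have hs := (bS_pos hn0 hx).ne'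
      apply ContinuousAt.continuousWithinAt
      fun_prop (disch := assumption))
    hpos p r0 hr0 ea eb
  have h2' : ∀ x, n < x → HasDerivAt ψ
      (bS n x / x + (x * (x^2+4*n^2)/(4 * bS n x^5)) * (b x^2/(a x^2+b x^2))) x := by
    intro x hx
    have hx0 := hn0.trans hx
    have hs := bS_pos hn0 hx
    have hsq := bS_sq hn0 hx.le
    have hp := (hpos x hx).ne'
    refine (h2 x hx).congr_deriv ?_
    rw [div_eq_iff hp, add_mul _ _ (a x^2+b x^2), mul_assoc _ _ (a x^2+b x^2), div_mul_cancel₀ _ hp]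
    simp only [ha, hb]
    rw [← hsq]
    have hn2 : n^2 = x^2 - bS n x^2 := by rw [hsq]; ring
    rw [hn2]
    generalize bS n x = S at *
    field_simp
    ring
  have hx1d : ∀ x, x1 ≤ x → n < x := fun x hx => hnx.trans_le hx
  have cψ : ContinuousOn ψ (Set.Ici x1) := fun x hx =>
    (h2 x (hx1d x hx)).continuousAt.continuousWithinAt
  have cT : ContinuousOn (bT n) (Set.Ici x1) := (bT_cont hn0).mono (Set.Ici_subset_Ici.2 hnx.le)
  have cE : ContinuousOn (bE n) (Set.Ici x1) := fun x hx =>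
    (bE_deriv hn0 (hx1d x hx)).continuousAt.continuousWithinAt
  have rat : ∀ x, n < x → 0 ≤ b x^2/(a x^2+b x^2) ∧ b x^2/(a x^2+b x^2) ≤ 1 := by
    intro x hx
    refine ⟨by positivity, ?_⟩
    rw [div_le_one (hpos x hx)]
    nlinarith [sq_nonneg (a x)]
  have m1 : MonotoneOn (fun x => ψ x - bT n x) (Set.Ici x1) := by
    apply monotoneOn_of_deriv_nonneg (convex_Ici x1) (cψ.sub cT)
    · rw [interior_Ici]
      intro x hx
      have hx : n < x := hnx.trans hx
      exact ((h2 x hx).sub (bT_deriv hn0 hx)).differentiableAt.differentiableWithinAt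
    · rw [interior_Ici]
      intro x hx
      have hx : n < x := hnx.trans hx
      rw [((h2' x hx).sub (bT_deriv hn0 hx)).deriv]
      have hx0 := hn0.trans hx
      have hs := bS_pos hn0 hx
      have := (rat x hx).1
      rw [add_sub_cancel_left]
      positivity
  have m2 : AntitoneOn (fun x => ψ x - bT n x + bE n x) (Set.Ici x1) := by
    apply antitoneOn_of_deriv_nonpos (convex_Ici x1) ((cψ.sub cT).add cE)
    · rw [interior_Ici]
      intro x hx
      have hx : n < x := hnx.trans hx
      exact (((h2 x hx).sub (bT_deriv hn0 hx)).add (bE_deriv hn0 hx)).differentiableAt.differentiableWithinAt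
    · rw [interior_Ici]
      intro x hx
      have hx : n < x := hnx.trans hx
      rw [(((h2' x hx).sub (bT_deriv hn0 hx)).add (bE_deriv hn0 hx)).deriv]
      have hx0 := hn0.trans hx
      have hs := bS_pos hn0 hx
      have h1 := (rat x hx).2
      have h0 : 0 ≤ x * (x^2+4*n^2)/(4 * bS n x^5) := by positivity
      rw [add_sub_cancel_left]
      nlinarith [mul_le_mul_of_nonneg_left h1 h0]
  have Epos : ∀ x, n < x → 0 ≤ bE n x := by
    intro x hx
    have hs := bS_pos hn0 hx
    unfold bE; positivity
  -- the limit
  set f : ℝ → ℝ := fun x => ψ (max x x1) - bT n (max x x1) with hf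
  have mf : Monotone f := by
    intro x y hxy
    exact m1 (le_max_right x x1) (le_max_right y x1) (max_le_max_right _ hxy)
  have bf : BddAbove (Set.range f) := by
    refine ⟨ψ x1 - bT n x1 + bE n x1, ?_⟩
    rintro _ ⟨x, rfl⟩
    have := m2 (Set.mem_Ici.2 le_rfl) (le_max_right x x1) (le_max_right x x1)
    have h0 := Epos _ (hx1d _ (le_max_right x x1))
    simp only at this
    simp only [hf]
    linarith
  have tf := tendsto_atTop_ciSup mf bf
  set l := ⨆ x, f x with hl
  have tl : Filter.Tendsto (fun x => ψ x - bT n x) Filter.atTop (nhds l) := by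
    refine tf.congr' ?_
    filter_upwards [Filter.eventually_ge_atTop x1] with x hx
    simp only [hf, max_eq_left hx]
  have low : ∀ x, x1 ≤ x → ψ x - bT n x ≤ l := by
    intro x hx
    have := mf.ge_of_tendsto tf x
    simpa only [hf, max_eq_left hx] using this
  have up : ∀ x, x1 ≤ x → l ≤ ψ x - bT n x + bE n x := by
    intro x hx
    have t2 := tl.add (bE_tendsto n)
    rw [add_zero] at t2
    refine le_of_tendsto t2 ?_
    filter_upwards [Filter.eventually_ge_atTop x] with y hy
    exact m2 hx (hx.trans hy) hy
  have h3' : ∀ x, x1 ≤ x → ∃ r, 0 < r ∧ V x + x^2/(2 * bS n x^2) * J x = r * Real.cos (ψ x) ∧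
        bS n x * J x = r * Real.sin (ψ x) := fun x hx => h3 x (hx1d x hx)
  obtain ⟨j, hj⟩ := phase_limit B ψ x1 h3' l tl
  have hl1 := low x1 le_rfl
  have hl2 := up x1 le_rfl
  have hx1sq : x1^2 = n^2 + q^2 := by rw [hx1]; exact Real.sq_sqrt (by positivity)
  have t1 : bT n x1 ≤ 1 := by
    refine (bT_le hn0 hnx.le).trans ?_
    rw [hSx1, hq3, hx1sq, div_le_one (by positivity)]
    nlinarith
  have t0 : 0 ≤ bT n x1 := by
    have := (bT_mono hn0).monotoneOn (Set.mem_Ici.2 le_rfl) hnx.le hnx.le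
    rwa [bT_self hn0] at this
  have e1 : bE n x1 ≤ 2/3 := by
    unfold bE
    rw [hSx1, hq3]
    have : 1/(4*q) ≤ 1/4 := by
      apply one_div_le_one_div_of_le <;> linarith
    have h5 : 5*n^2/(12*n^2) = 5/12 := by field_simp
    rw [h5]; linarith
  rw [h1] at hl1 hl2
  have hpi := Real.pi_gt_three
  have hj0 : j = 0 := by
    have a1 : -1 < j := by
      by_contra hcon
      have : j ≤ -1 := by omega
      have : (j:ℝ) ≤ -1 := by exact_mod_cast this
      nlinarith
    have a2 : j < 1 := by
      by_contra hcon
      have : 1 ≤ j := by omega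
      have : (1:ℝ) ≤ j := by exact_mod_cast this
      nlinarith
    omega
  rw [hj0] at hj
  simp at hj
  refine ⟨ψ, by rwa [h1], by rwa [h1], cψ, h3', fun x hx => ?_, fun x hx => ?_⟩
  · linarith [low x hx]
  · linarith [up x hx]

lemma floor_imp (u v α β j : ℝ) (hα : 0 < α) (hβ : 0 < β) (hu : Real.sin u = α * j)
    (hv : Real.sin v = β * j) (huv : |u - v| < π) (m : ℕ) (h : m * π ≤ u) : m * π ≤ v := by
  by_contra hc
  push Not at hc
  have h1 := abs_lt.1 huv
  have s1 : 0 ≤ Real.sin (u - m * π) := Real.sin_nonneg_of_nonneg_of_le_pi (by linarith) (by linarith)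
  have s2 : Real.sin (v - m * π) < 0 := Real.sin_neg_of_neg_of_neg_pi_lt (by linarith) (by linarith)
  rw [Real.sin_sub_nat_mul_pi] at s1 s2
  rw [hu, show (-1:ℝ)^m * (α * j) = α * ((-1)^m * j) by ring] at s1
  rw [hv, show (-1:ℝ)^m * (β * j) = β * ((-1)^m * j) by ring] at s2
  have s1 := nonneg_of_mul_nonneg_right s1 hα
  have := mul_nonneg hβ.le s1
  linarith

lemma phase_close (χ ψ J V κ S : ℝ → ℝ) (q x1 : ℝ) (hq : 0 < q) (hS : ∀ x, x1 ≤ x → 0 < S x)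
    (cχ : ContinuousOn χ (Set.Ici x1)) (cψ : ContinuousOn ψ (Set.Ici x1))
    (hχ : ∀ x, x1 ≤ x → ∃ r, 0 < r ∧ V x = r * Real.cos (χ x) ∧ q * J x = r * Real.sin (χ x))
    (hψ : ∀ x, x1 ≤ x → ∃ r, 0 < r ∧ V x + κ x * J x = r * Real.cos (ψ x) ∧ S x * J x = r * Real.sin (ψ x))
    (h1 : |ψ x1 - χ x1| < π) (x : ℝ) (hx : x1 ≤ x) : |ψ x - χ x| < π := by
  by_contra hc
  push Not at hc
  have cc : ContinuousOn (fun x => |ψ x - χ x|) (Set.Icc x1 x) :=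
    ((cψ.sub cχ).abs).mono Set.Icc_subset_Ici_self
  obtain ⟨z, hz, ez⟩ := intermediate_value_Icc hx cc ⟨h1.le, hc⟩
  obtain ⟨r, hr, a1, a2⟩ := hχ z hz.1
  obtain ⟨s, hs, b1, b2⟩ := hψ z hz.1
  have hS := hS z hz.1
  simp only at ez
  have hcs : Real.cos (ψ z) = - Real.cos (χ z) ∧ Real.sin (ψ z) = - Real.sin (χ z) := by
    rcases (abs_eq Real.pi_pos.le).1 ez with h | h
    · rw [show ψ z = χ z + π by linarith, Real.cos_add_pi, Real.sin_add_pi]; exact ⟨rfl, rfl⟩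
    · rw [show ψ z = χ z - π by linarith, Real.cos_sub_pi, Real.sin_sub_pi]; exact ⟨rfl, rfl⟩
  rw [hcs.1] at b1
  rw [hcs.2] at b2
  have hJ : J z = 0 := by
    have : (S z * r + q * s) * J z = 0 := by linear_combination r * b2 + s * a2
    have h0 : 0 < S z * r + q * s := by positivity
    exact (mul_eq_zero.1 this).resolve_left h0.ne'
  rw [hJ] at a2 b1
  have hsin : Real.sin (χ z) = 0 := by
    have : r * Real.sin (χ z) = 0 := by linarith
    exact (mul_eq_zero.1 this).resolve_left hr.ne'
  have hcos : Real.cos (χ z) = 0 := by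
    have : (r + s) * Real.cos (χ z) = 0 := by linear_combination -a1 + b1
    exact (mul_eq_zero.1 this).resolve_left (by positivity)
  have := Real.sin_sq_add_cos_sq (χ z)
  rw [hsin, hcos] at this
  norm_num at this

/-- Threshold comparison at one point. -/
lemma thresh (χ ψ J V κ0 S q σ r s w κ : ℝ) (hq : 0 < q) (hS : 0 < S) (hσ : 0 < σ)
    (hr : 0 < r) (hs : 0 < s)
    (a1 : V = r * Real.cos χ) (a2 : q * J = r * Real.sin χ)
    (b1 : V + κ0 * J = s * Real.cos ψ) (b2 : S * J = s * Real.sin ψ)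
    (hcl : |ψ - χ| < π) (hw : w = Real.arctan (σ/q)) (hκ : κ = (κ0 - σ)/S) (m : ℕ) :
    (m * π + π/2 + (π/2) * |κ| ≤ ψ → w + π/2 + m * π ≤ χ) ∧
    (w + π/2 + m * π ≤ χ → m * π ≤ ψ ∧ m * π + π/2 - (π/2) * |κ| ≤ ψ) := by
  have hpi := Real.pi_pos
  have w1 : 0 < w := by rw [hw]; exact Real.arctan_pos.2 (by positivity)
  have w2 : w < π/2 := by rw [hw]; exact Real.arctan_lt_pi_div_two _
  have cw : 0 < Real.cos w := Real.cos_pos_of_mem_Ioo ⟨by linarith, w2⟩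
  have sw : q * Real.sin w = σ * Real.cos w := by
    have := Real.tan_arctan (σ/q)
    rw [← hw, Real.tan_eq_sin_div_cos] at this
    field_simp at this
    linarith
  -- same floors
  have e1 : Real.sin χ = (q/r) * J := by field_simp; linarith
  have e2 : Real.sin ψ = (S/s) * J := by field_simp; linarith
  have F1 : ∀ m : ℕ, m * π ≤ ψ → m * π ≤ χ := fun m h =>
    floor_imp ψ χ (S/s) (q/r) J (by positivity) (by positivity) e2 e1 hcl m h
  have F2 : ∀ m : ℕ, m * π ≤ χ → m * π ≤ ψ := fun m h =>
    floor_imp χ ψ (q/r) (S/s) J (by positivity) (by positivity) e1 e2 (by rwa [abs_sub_comm]) m h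
  -- two representations of the Robin function
  have R1 : (V + σ * J) * Real.cos w = r * Real.cos (χ - w) := by
    rw [Real.cos_sub]
    linear_combination Real.cos w * a1 + Real.sin w * a2 - J * sw
  have R2 : V + σ * J = s * (Real.cos ψ - κ * Real.sin ψ) := by
    rw [hκ]
    have : J = s * Real.sin ψ / S := by field_simp; linarith
    have h2 : s * (Real.cos ψ - (κ0 - σ)/S * Real.sin ψ) = s * Real.cos ψ - (κ0 - σ) * (s * Real.sin ψ / S) := by
      ring
    rw [h2, ← this]
    linarith
  have sg : ((-1:ℝ)^m) * (-1)^m = 1 := by rw [← mul_pow]; simp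
  have C1 : Real.cos (χ - w) = (-1)^m * Real.cos (χ - m * π - w) := by
    rw [show χ - m * π - w = (χ - w) - m * π by ring, Real.cos_sub_nat_mul_pi, ← mul_assoc, sg, one_mul]
  have C2 : Real.cos ψ = (-1)^m * Real.cos (ψ - m * π) := by
    rw [Real.cos_sub_nat_mul_pi, ← mul_assoc, sg, one_mul]
  have C3 : Real.sin ψ = (-1)^m * Real.sin (ψ - m * π) := by
    rw [Real.sin_sub_nat_mul_pi, ← mul_assoc, sg, one_mul]
  have key : r * Real.cos (χ - m * π - w) =
      s * Real.cos w * (Real.cos (ψ - m * π) - κ * Real.sin (ψ - m * π)) := by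
    have : (-1:ℝ)^m * (r * Real.cos (χ - m * π - w)) =
      (-1)^m * (s * Real.cos w * (Real.cos (ψ - m * π) - κ * Real.sin (ψ - m * π))) := by
      rw [R2, C1, C2, C3] at R1
      linear_combination -R1
    exact mul_left_cancel₀ (pow_ne_zero _ (by norm_num)) this
  have kap : |κ * Real.sin (ψ - m * π)| ≤ |κ| := by
    rw [abs_mul]; exact mul_le_of_le_one_right (abs_nonneg _) (Real.abs_sin_le_one _)
  have kap' := abs_le.1 kap
  have k0 := abs_nonneg κ
  have pk : 0 ≤ π/2 * |κ| := by positivity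
  constructor
  · intro h
    by_contra hc
    push Not at hc
    have u0 := F1 m (by linarith)
    have v1 : ψ < m * π + π := by
      by_contra hh
      have := F2 
      have := F1 (m+1) (by push_cast; linarith)
      push_cast at this
      linarith
    have p1 : 0 < Real.cos (χ - m * π - w) := Real.cos_pos_of_mem_Ioo ⟨by linarith, by linarith⟩
    have p2 : Real.cos (ψ - m * π) ≤ -|κ| := by
      have := Real.mul_le_sin (x := ψ - m * π - π/2) (by linarith) (by linarith)
      rw [Real.sin_sub_pi_div_two] at this
      have h4 : |κ| ≤ 2/π * (ψ - m * π - π/2) := by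
        rw [div_mul_eq_mul_div, le_div_iff₀ hpi]
        linarith
      linarith
    have p3 : s * Real.cos w * (Real.cos (ψ - m * π) - κ * Real.sin (ψ - m * π)) ≤ 0 :=
      mul_nonpos_of_nonneg_of_nonpos (by positivity) (by linarith)
    have := mul_pos hr p1
    linarith
  · intro h
    have v0 := F2 m (by linarith)
    refine ⟨v0, ?_⟩
    by_contra hc
    push Not at hc
    have u1 : χ < m * π + π := by
      by_contra hh
      have := F2 (m+1) (by push_cast; linarith)
      push_cast at this
      linarith
    have p1 : Real.cos (χ - m * π - w) ≤ 0 :=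
      Real.cos_nonpos_of_pi_div_two_le_of_le (by linarith) (by linarith)
    have p2 : |κ| < Real.cos (ψ - m * π) := by
      have := Real.mul_le_sin (x := π/2 - (ψ - m * π)) (by linarith) (by linarith)
      rw [Real.sin_pi_div_two_sub] at this
      have h4 : |κ| < 2/π * (π/2 - (ψ - m * π)) := by
        rw [div_mul_eq_mul_div, lt_div_iff₀ hpi]
        linarith
      linarith
    have p3 : 0 < s * Real.cos w * (Real.cos (ψ - m * π) - κ * Real.sin (ψ - m * π)) :=
      mul_pos (by positivity) (by linarith)
    have := mul_nonpos_of_nonneg_of_nonpos hr.le p1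
    linarith

lemma main_phase {n : ℝ} {J V : ℝ → ℝ} (B : BSys n J V) (σ : ℝ) (hσ : 0 < σ) :
    ∃ (χ : ℝ → ℝ) (w x1 : ℝ), π/2 < w ∧ w < π ∧ 0 < χ n ∧ χ n < π/2 ∧
      StrictMonoOn χ (Set.Ici n) ∧ ContinuousOn χ (Set.Ici n) ∧
      (∀ x, 0 < x → ∃ ρ, 0 < ρ ∧ V x + σ * J x = ρ * Real.sin (w - χ x)) ∧
      n < x1 ∧ χ x1 < π ∧ bT n x1 ≤ 1 ∧
      (∀ x, x1 ≤ x → ∀ m : ℕ, m * π + π/4 + (2/3 + π/4 + π*σ/2) * (x^2/bS n x^3) ≤ bT n x →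
        w + m * π ≤ χ x) ∧
      (∀ x, x1 ≤ x → ∀ m : ℕ, w + m * π ≤ χ x → m * π - π/4 ≤ bT n x ∧
        m * π + π/4 - (2/3 + π/4 + π*σ/2) * (x^2/bS n x^3) ≤ bT n x) := by
  have hn0 : 0 < n := by linarith [B.hn]
  have hpi := Real.pi_pos
  obtain ⟨q, hq, hq3⟩ : ∃ q : ℝ, 1 ≤ q ∧ q^3 = n^2 := by
    refine ⟨n^((2:ℝ)/3), Real.one_le_rpow B.hn (by norm_num), ?_⟩
    rw [← Real.rpow_natCast, ← Real.rpow_mul hn0.le]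
    norm_num
  have hq0 : 0 < q := by linarith
  obtain ⟨χ, c0, c1, c2, c3, c4, c5⟩ := chi_exists B q hq hq3
  obtain ⟨x1, hx1⟩ : ∃ x1, x1 = √(n^2+q^2) := ⟨_, rfl⟩
  rw [← hx1] at c5
  have hnx : n < x1 := by
    rw [hx1]; apply Real.lt_sqrt_of_sq_lt; nlinarith
  have hSx1 : bS n x1 = q := by
    rw [bS, hx1, Real.sq_sqrt (by positivity)]
    rw [show n^2+q^2-n^2 = q^2 by ring, Real.sqrt_sq hq0.le]
  have hx1sq : x1^2 = n^2 + q^2 := by rw [hx1]; exact Real.sq_sqrt (by positivity)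
  have c6 : 0 < χ x1 := c0.trans (c3 (Set.mem_Ici.2 le_rfl) hnx.le hnx)
  have hJ1 : 0 < J x1 := by
    obtain ⟨r, hr, -, h⟩ := c2 x1 (hn0.trans hnx)
    have : 0 < q * J x1 := by rw [h]; exact mul_pos hr (Real.sin_pos_of_pos_of_lt_pi c6 c5)
    exact pos_of_mul_pos_right this hq0.le
  obtain ⟨ψ, d0, d1, d2, d3, d4, d5⟩ := psi_exists B q hq hq3 x1 hx1 hJ1
  have hcl : ∀ x, x1 ≤ x → |ψ x - χ x| < π := by
    apply phase_close χ ψ J V (fun x => x^2/(2 * bS n x^2)) (bS n) q x1 hq0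
      (fun x hx => bS_pos hn0 (hnx.trans_le hx)) (c4.mono (Set.Ici_subset_Ici.2 hnx.le)) d2
      (fun x hx => c2 x (hn0.trans (hnx.trans_le hx))) d3
    rw [abs_lt]; constructor <;> linarith
  have w1 : 0 < Real.arctan (σ/q) := Real.arctan_pos.2 (by positivity)
  have w2 : Real.arctan (σ/q) < π/2 := Real.arctan_lt_pi_div_two _
  have bnd : ∀ x, x1 ≤ x → bE n x + π/2 * |(x^2/(2 * bS n x^2) - σ)/bS n x| ≤
      (2/3 + π/4 + π*σ/2) * (x^2/bS n x^3) ∧ 0 ≤ bE n x := by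
    intro x hx
    have hnx' := hnx.trans_le hx
    have hx0 := hn0.trans hnx'
    have hs := bS_pos hn0 hnx'
    have hsq := bS_sq hn0 hnx'.le
    have hn2 : n^2 ≤ x^2 := by nlinarith
    have hs2 : bS n x^2 ≤ x^2 := by nlinarith
    have i1 : 1/bS n x ≤ x^2/bS n x^3 := by
      rw [div_le_div_iff₀ hs (by positivity)]
      nlinarith [mul_le_mul_of_nonneg_right hs2 hs.le]
    have i2 : n^2/bS n x^3 ≤ x^2/bS n x^3 := by gcongr
    have e1 : bE n x = 1/4 * (1/bS n x) + 5/12 * (n^2/bS n x^3) := by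
      unfold bE; field_simp
    have e2 : |(x^2/(2 * bS n x^2) - σ)/bS n x| ≤ 1/2 * (x^2/bS n x^3) + σ * (1/bS n x) := by
      have : (x^2/(2 * bS n x^2) - σ)/bS n x = 1/2 * (x^2/bS n x^3) - σ * (1/bS n x) := by field_simp
      rw [this]
      have p1 : 0 ≤ 1/2 * (x^2/bS n x^3) := by positivity
      have p2 : 0 ≤ σ * (1/bS n x) := by positivity
      rw [abs_le]; constructor <;> linarith
    have e3 : |(x^2/(2 * bS n x^2) - σ)/bS n x| ≤ (1/2 + σ) * (x^2/bS n x^3) := by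
      have := mul_le_mul_of_nonneg_left i1 hσ.le
      linarith
    have e4 := mul_le_mul_of_nonneg_left e3 (by positivity : 0 ≤ π/2)
    have e5 : 0 ≤ bE n x := by rw [e1]; positivity
    refine ⟨?_, e5⟩
    rw [e1]
    linarith
  refine ⟨χ, Real.arctan (σ/q) + π/2, x1, by linarith, by linarith, c0, c1, c3, c4, ?_, hnx, c5, ?_, ?_, ?_⟩
  · intro x hx
    obtain ⟨r, hr, a1, a2⟩ := c2 x hx
    have cw : 0 < Real.cos (Real.arctan (σ/q)) := Real.cos_arctan_pos _
    have sw : q * Real.sin (Real.arctan (σ/q)) = σ * Real.cos (Real.arctan (σ/q)) := by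
      have := Real.tan_arctan (σ/q)
      rw [Real.tan_eq_sin_div_cos] at this
      field_simp at this
      linarith
    refine ⟨r / Real.cos (Real.arctan (σ/q)), by positivity, ?_⟩
    rw [show Real.arctan (σ/q) + π/2 - χ x = (Real.arctan (σ/q) - χ x) + π/2 by ring,
      Real.sin_add_pi_div_two, Real.cos_sub]
    field_simp
    linear_combination Real.cos (Real.arctan (σ/q)) * a1 + Real.sin (Real.arctan (σ/q)) * a2 - J x * sw
  · refine (bT_le hn0 hnx.le).trans ?_
    rw [hSx1, hq3, hx1sq, div_le_one (by positivity)]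
    nlinarith
  · intro x hx m h
    obtain ⟨r, hr, a1, a2⟩ := c2 x (hn0.trans (hnx.trans_le hx))
    obtain ⟨s, hs, b1, b2⟩ := d3 x hx
    have := (thresh (χ x) (ψ x) (J x) (V x) _ (bS n x) q σ r s _ _ hq0
      (bS_pos hn0 (hnx.trans_le hx)) hσ hr hs a1 a2 b1 b2 (hcl x hx) rfl rfl m).1
    apply this
    linarith [(bnd x hx).1, d5 x hx]
  · intro x hx m h
    obtain ⟨r, hr, a1, a2⟩ := c2 x (hn0.trans (hnx.trans_le hx))
    obtain ⟨s, hs, b1, b2⟩ := d3 x hx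
    have := (thresh (χ x) (ψ x) (J x) (V x) _ (bS n x) q σ r s _ _ hq0
      (bS_pos hn0 (hnx.trans_le hx)) hσ hr hs a1 a2 b1 b2 (hcl x hx) rfl rfl m).2 h
    have hb := bnd x hx
    have := d4 x hx
    constructor <;> linarith

lemma count_iff (n μ w : ℝ) (χ F : ℝ → ℝ) (hn : 0 < n)
    (h1 : χ n < w) (h2 : w - π < χ n)
    (hm : StrictMonoOn χ (Set.Ici n)) (hc : ContinuousOn χ (Set.Ici n))
    (hF : ∀ x, 0 < x → ∃ ρ, 0 < ρ ∧ F x = ρ * Real.sin (w - χ x))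
    (hF0 : ∀ x, 0 < x → x ≤ n → F x ≠ 0) (m : ℕ) :
    m + 1 ≤ ({t : ℝ | t ∈ Set.Ioc 0 μ ∧ F t = 0}).ncard ↔ n ≤ μ ∧ w + m * π ≤ χ μ := by
  have hpi := Real.pi_pos
  set Z := {t : ℝ | t ∈ Set.Ioc 0 μ ∧ F t = 0} with hZ
  have zmem : ∀ t, t ∈ Z → n < t ∧ t ≤ μ := by
    rintro t ⟨⟨h, h'⟩, h0⟩
    refine ⟨?_, h'⟩
    by_contra hh
    exact hF0 t h (not_lt.1 hh) h0
  have zero_iff : ∀ t, 0 < t → (F t = 0 ↔ Real.sin (w - χ t) = 0) := by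
    intro t ht
    obtain ⟨ρ, hρ, e⟩ := hF t ht
    rw [e]
    simp [hρ.ne']
  have sub : ∀ M : ℕ, χ μ < w + M * π → 
      χ '' Z ⊆ ((Finset.range M).image (fun j : ℕ => w + j * π) : Finset ℝ) := by
    rintro M hM _ ⟨t, ht, rfl⟩
    obtain ⟨hnt, htμ⟩ := zmem t ht
    have := (zero_iff t ht.1.1).1 ht.2
    rw [Real.sin_eq_zero_iff] at this
    obtain ⟨i, hi⟩ := this
    have g1 : χ n < χ t := hm (Set.mem_Ici.2 le_rfl) hnt.le hnt
    have g2 : χ t ≤ χ μ := hm.monotoneOn hnt.le (hnt.le.trans htμ) htμ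
    have i1 : i < 1 := by
      by_contra hh
      have : (1:ℝ) ≤ i := by exact_mod_cast not_lt.1 hh
      nlinarith
    have i2 : -i < M := by
      by_contra hh
      have : (M:ℝ) ≤ -i := by exact_mod_cast not_lt.1 hh
      nlinarith
    obtain ⟨j, hj⟩ : ∃ j : ℕ, -i = j := ⟨(-i).toNat, by omega⟩
    have hj' : (i:ℝ) = -j := by
      have : i = -(j:ℤ) := by omega
      rw [this]; push_cast; ring
    simp only [Finset.coe_image, Set.mem_image, Finset.coe_range, Set.mem_Iio]
    refine ⟨j, by omega, ?_⟩
    rw [hj'] at hi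
    linarith
  have inj : Set.InjOn χ Z := fun a ha b hb hab => 
    hm.injOn (zmem a ha).1.le (zmem b hb).1.le hab
  have fin : Z.Finite := by
    obtain ⟨M, hM⟩ := exists_nat_gt ((χ μ - w)/π)
    have : χ μ < w + M * π := by
      rw [div_lt_iff₀ hpi] at hM; linarith
    exact Set.Finite.of_finite_image ((Finset.finite_toSet _).subset (sub M this)) inj
  constructor
  · intro h
    have ne : Z.Nonempty := by
      rw [← Set.ncard_pos fin]; omega
    obtain ⟨t, ht⟩ := ne
    refine ⟨(zmem t ht).1.le.trans (zmem t ht).2, ?_⟩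
    by_contra hh
    have := sub m (not_le.1 hh)
    have c1 : Z.ncard ≤ m := by
      rw [← inj.ncard_image]
      refine (Set.ncard_le_ncard this (Finset.finite_toSet _)).trans ?_
      rw [Set.ncard_coe_finset]
      refine Finset.card_image_le.trans ?_
      simp
    omega
  · rintro ⟨hμ, hχ⟩
    have ex : ∀ j : ℕ, j ≤ m → ∃ t ∈ Z, χ t = w + j * π := by
      intro j hj
      have hjm : (j:ℝ) * π ≤ m * π := by gcongr
      have hj0 : 0 ≤ (j:ℝ) * π := by positivity
      obtain ⟨t, ht, e⟩ := intermediate_value_Icc hμ (hc.mono Set.Icc_subset_Ici_self)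
        (show w + j * π ∈ Set.Icc (χ n) (χ μ) from ⟨by linarith, by linarith⟩)
      have ht0 : 0 < t := hn.trans_le ht.1
      refine ⟨t, ⟨⟨ht0, ht.2⟩, ?_⟩, e⟩
      rw [zero_iff t ht0, e, show w - (w + j * π) = -(j * π) by ring, Real.sin_neg, Real.sin_nat_mul_pi, neg_zero]
    have s2 : (((Finset.range (m+1)).image (fun j : ℕ => w + j * π) : Finset ℝ) : Set ℝ) ⊆ (χ '' Z) := by
      intro y hy
      simp only [Finset.coe_image, Set.mem_image, Finset.coe_range, Set.mem_Iio] at hy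
      obtain ⟨j, hj, rfl⟩ := hy
      obtain ⟨t, ht, e⟩ := ex j (by omega)
      exact ⟨t, ht, e⟩
    rw [← inj.ncard_image]
    have := Set.ncard_le_ncard s2 (fin.image χ)
    rw [Set.ncard_coe_finset, Finset.card_image_of_injective] at this
    · simpa using this
    · intro a b hab
      simp only [add_right_inj, mul_eq_mul_right_iff, Nat.cast_inj] at hab
      exact hab.resolve_right hpi.ne'

lemma bessel_nonvan (n : ℕ) (x : ℝ) (hx : 0 < x) :
    0 < (x * deriv (besselJ n) x)^2 + besselJ n x ^ 2 := by
  obtain ⟨x0, hx0, h0⟩ : ∃ x0 : ℝ, 0 < x0 ∧ 0 < (x0 * deriv (besselJ n) x0)^2 + besselJ n x0 ^ 2 := by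
    by_contra hcon
    push Not at hcon
    have hz : ∀ x : ℝ, 0 < x → x * deriv (besselJ n) x = 0 ∧ besselJ n x = 0 := by
      intro x hx
      have := hcon x hx
      constructor
      · have : (x * deriv (besselJ n) x)^2 = 0 := by
          nlinarith [sq_nonneg (x * deriv (besselJ n) x), sq_nonneg (besselJ n x)]
        exact pow_eq_zero_iff two_ne_zero |>.1 this
      · have : (besselJ n x)^2 = 0 := by
          nlinarith [sq_nonneg (x * deriv (besselJ n) x), sq_nonneg (besselJ n x)]
        exact pow_eq_zero_iff two_ne_zero |>.1 this
    have a1 := (bj_asymp n).pow 2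
    have a2 := (bj_asympV n).pow 2
    have a3 := a1.add a2
    have a4 : Filter.Tendsto (fun _ : ℝ => bA^2) Filter.atTop (nhds ((0:ℝ)^2+0^2)) := by
      refine a3.congr' ?_
      filter_upwards [Filter.eventually_gt_atTop 0] with x hx
      rw [(hz x hx).1, (hz x hx).2]
      have := Real.sin_sq_add_cos_sq (x - (n*(π/2) + π/4))
      linear_combination bA^2 * this
    have := tendsto_nhds_unique a4 tendsto_const_nhds
    have hA := bA_pos
    have : 0 < bA^2 := by positivity
    linarith
  exact nonvan (n := (n:ℝ)) (J := besselJ n) (V := fun x => x * deriv (besselJ n) x)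
    (bj_J n) (bj_V n) x0 hx0 h0 x hx

lemma bessel_sign (n : ℕ) (hn : 1 ≤ n) (x : ℝ) (hx : 0 < x) (hxn : x ≤ n) :
    0 < besselJ n x * (x * deriv (besselJ n) x) := by
  have hn0 : (0:ℝ) < n := by exact_mod_cast hn
  refine sign_small (n := (n:ℝ)) (J := besselJ n) (V := fun x => x * deriv (besselJ n) x) hn0
    (bj_J n) (bj_V n) (bessel_nonvan n) ?_ (by simp) x hx hxn
  have c : ∀ n, Continuous (besselJ n) := fun n =>
    continuous_iff_continuousAt.2 fun x => (bj_deriv0 n x).continuousAt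
  have e : (fun x => besselJ n x * (x * deriv (besselJ n) x)) =
      fun x => besselJ n x * (n * besselJ n x - x * besselJ (n+1) x) := by
    funext x; rw [bj_d1]
  rw [e]
  have c1 := c n
  have c2 := c (n+1)
  apply Continuous.continuousWithinAt
  fun_prop

lemma bessel_sys (n : ℕ) (hn : 1 ≤ n) : ∃ ε : ℝ, ε ≠ 0 ∧
    BSys n (fun x => ε * besselJ n x) (fun x => ε * (x * deriv (besselJ n) x)) := by
  have hn1 : (1:ℝ) ≤ n := by exact_mod_cast hn
  have hn0 : (0:ℝ) < n := by linarith
  have hs := bessel_sign n hn n hn0 le_rfl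
  have hne : besselJ n n ≠ 0 := by
    rintro h; rw [h] at hs; simp at hs
  have hA := bA_pos
  refine ⟨besselJ n n, hne, ⟨hn1, ?_, ?_, ?_, ?_, hs, besselJ n n * bA, by positivity, ?_, ?_⟩⟩
  · intro x hx
    refine ((bj_J n x hx).const_mul (besselJ n n)).congr_deriv ?_
    ring
  · intro x hx
    refine ((bj_V n x hx).const_mul (besselJ n n)).congr_deriv ?_
    ring
  · intro x hx
    have := mul_pos (by positivity : 0 < (besselJ n n)^2) (bessel_nonvan n x hx)
    linarith
  · exact mul_self_pos.2 hne
  · have := (bj_asymp n).const_mul (besselJ n n)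
    rw [mul_zero] at this
    refine this.congr fun x => ?_
    ring
  · have := (bj_asympV n).const_mul (besselJ n n)
    rw [mul_zero] at this
    refine this.congr fun x => ?_
    ring

lemma bessel_row (n : ℕ) (hn : 1 ≤ n) (σ : ℝ) (hσ : 0 < σ) : ∃ x1 : ℝ, (n:ℝ) < x1 ∧ bT n x1 ≤ 1 ∧
    (∀ μ, x1 ≤ μ → ∀ m : ℕ, m * π + π/4 + (2/3 + π/4 + π*σ/2) * (μ^2/bS n μ^3) ≤ bT n μ →
      m + 1 ≤ ({t : ℝ | t ∈ Set.Ioc 0 μ ∧ phiRobin σ n t = 0}).ncard) ∧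
    (∀ μ, ∀ m : ℕ, 1 ≤ m → m + 1 ≤ ({t : ℝ | t ∈ Set.Ioc 0 μ ∧ phiRobin σ n t = 0}).ncard →
      x1 ≤ μ ∧ m * π - π/4 ≤ bT n μ ∧
        m * π + π/4 - (2/3 + π/4 + π*σ/2) * (μ^2/bS n μ^3) ≤ bT n μ) := by
  have hn1 : (1:ℝ) ≤ n := by exact_mod_cast hn
  have hn0 : (0:ℝ) < n := by linarith
  have hpi := Real.pi_pos
  obtain ⟨ε, hε, B⟩ := bessel_sys n hn
  obtain ⟨χ, w, x1, w1, w2, c0, c1, cm, cc, cF, hx1, cx1, t1, L1, L2⟩ := main_phase B σ hσ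
  have hset : ∀ μ : ℝ, {t : ℝ | t ∈ Set.Ioc 0 μ ∧ phiRobin σ n t = 0} = 
      {t : ℝ | t ∈ Set.Ioc 0 μ ∧ ε * (t * deriv (besselJ n) t) + σ * (ε * besselJ n t) = 0} := by
    intro μ
    ext t
    simp only [Set.mem_ofPred_eq, phiRobin, besselJ']
    rw [show ε * (t * deriv (besselJ n) t) + σ * (ε * besselJ n t) =
      ε * (t * deriv (besselJ n) t + σ * besselJ n t) by ring]
    simp [hε]
  have hF0 : ∀ x : ℝ, 0 < x → x ≤ n → ε * (x * deriv (besselJ n) x) + σ * (ε * besselJ n x) ≠ 0 := by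
    intro x hx hxn h
    have h1 := bessel_sign n hn x hx hxn
    have h2 : ε * (x * deriv (besselJ n) x + σ * besselJ n x) = 0 := by linarith
    have h3 := (mul_eq_zero.1 h2).resolve_left hε
    have h4 : besselJ n x * (x * deriv (besselJ n) x) + σ * besselJ n x ^ 2 = 0 := by
      linear_combination besselJ n x * h3
    have : 0 ≤ σ * besselJ n x ^ 2 := by positivity
    linarith
  have cnt := fun μ m => count_iff (n:ℝ) μ w χ
    (fun t => ε * (t * deriv (besselJ n) t) + σ * (ε * besselJ n t)) hn0 (by linarith) (by linarith)
    cm cc cF hF0 m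
  refine ⟨x1, hx1, t1, ?_, ?_⟩
  · intro μ hμ m h
    rw [hset, cnt μ m]
    exact ⟨hx1.le.trans hμ, L1 μ hμ m h⟩
  · intro μ m hm h
    rw [hset, cnt μ m] at h
    have hm' : (1:ℝ) ≤ m := by exact_mod_cast hm
    have hx : x1 ≤ μ := by
      by_contra hh
      have := cm.monotoneOn h.1 hx1.le (not_le.1 hh).le
      nlinarith [h.2]
    exact ⟨hx, L2 μ hx m h.2⟩

lemma dom_iff (n M y : ℝ) (hn : 0 < n) (hM : 0 < M) (hy : 0 ≤ y) :
    (n, y) ∈ M • domD ↔ n ≤ M ∧ y * π ≤ bT n M := by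
  have hpi := Real.pi_pos
  rw [Set.mem_smul_set_iff_inv_smul_mem₀ hM.ne']
  simp only [domD, Set.mem_ofPred_eq, Prod.smul_mk, smul_eq_mul]
  have hr : 0 < M⁻¹ * n := by positivity
  have hy' : 0 ≤ M⁻¹ * y := by positivity
  have e1 : M⁻¹ * n ≤ 1 ↔ n ≤ M := by
    rw [inv_mul_le_iff₀ hM, mul_one]
  have e2 : n ≤ M → (M⁻¹ * y ≤ gfun (M⁻¹ * n) ↔ y * π ≤ bT n M) := by
    intro h
    have e : √(1 - (M⁻¹ * n)^2) = M⁻¹ * bS n M := by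
      rw [show 1 - (M⁻¹ * n)^2 = (M⁻¹ * bS n M)^2 by rw [mul_pow _ (bS n M), bS_sq hn h]; field_simp]
      exact Real.sqrt_sq (mul_nonneg (by positivity) (Real.sqrt_nonneg _))
    have e3 : gfun (M⁻¹ * n) = M⁻¹ * (bT n M / π) := by
      unfold gfun bT
      rw [e, show n / M = M⁻¹ * n by ring]
      ring
    rw [e3, mul_le_mul_iff_right₀ (by positivity), le_div_iff₀ hpi]
  constructor
  · rintro ⟨-, h2, -, h4⟩
    exact ⟨e1.1 h2, (e2 (e1.1 h2)).1 h4⟩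
  · rintro ⟨h1, h2⟩
    refine ⟨by linarith, e1.2 h1, ?_, (e2 h1).2 h2⟩
    rw [max_eq_left (by linarith)]
    exact hy'

/-- increment estimate -/
lemma incr_est (n M M' t K δ S : ℝ) (hn : 0 < n) (hM : n < M) (hMM : M' = M + δ) (ht : 0 < t)
    (hK : 0 < K) (hδ : δ = 16 * K / t^3) (hm1 : t^7/2 ≤ M) (hm2 : M ≤ t^7)
    (hθ : t^4 ≤ bT n M) (hS : bS n M ≤ S) :
    K * (t^14/S^3) ≤ bT n M' - bT n M := by
  have hM0 := hn.trans hM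
  have hs := bS_pos hn hM
  have hS0 := hs.trans_le hS
  have hδ0 : 0 < δ := by rw [hδ]; positivity
  have hθ0 : 0 ≤ bT n M := le_trans (by positivity) hθ
  have h1 := bT_incr hn hM.le (show M ≤ M' by linarith)
  have h2 := bT_le hn hM.le
  have h3 : (t^6/2)^3 ≤ bS n M^3 := by
    rw [le_div_iff₀ (by positivity)] at h2
    have : t^4 * (t^7/2)^2 ≤ bS n M^3 := by
      refine le_trans ?_ h2
      gcongr
    have h5 : (t^6/2)^3 ≤ t^4 * (t^7/2)^2 := by
      have : 0 < t^18 := by positivity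
      nlinarith
    linarith
  have h4 : t^6/2 ≤ bS n M := le_of_pow_le_pow_left₀ (by norm_num) hs.le h3
  refine le_trans ?_ h1
  rw [show M' - M = δ by linarith, hδ]
  have h5 : bS n M / t^7 ≤ bS n M / M := by gcongr
  refine le_trans ?_ (mul_le_mul_of_nonneg_left h5 (by positivity))
  rw [mul_div_assoc', div_mul_div_comm, div_le_div_iff₀ (by positivity) (by positivity)]
  have h6 : t^24/16 ≤ bS n M * S^3 := by
    calc t^24/16 = t^6/2 * (t^6/2)^3 := by ring
      _ ≤ bS n M * S^3 := by
        have := h4.trans hS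
        gcongr
  have := mul_le_mul_of_nonneg_left h6 (by positivity : 0 ≤ 16 * K)
  calc K * t^14 * (t^3 * t^7) = 16 * K * (t^24/16) := by ring
    _ ≤ 16 * K * (bS n M * S^3) := this
    _ = _ := by ring

theorem disk_row_count_large_k (σ c : ℝ) (hσ : 0 < σ) (hc : 0 < c) :
    ∃ C : ℝ, 0 < C ∧ ∃ μ₀ : ℝ, 0 < μ₀ ∧ ∀ μ : ℝ, μ₀ ≤ μ → ∀ k : ℕ,
      μ ^ ((4:ℝ)/7) < (k : ℝ) →
        latticeCountRow c k (μ - C * μ ^ (-(3:ℝ)/7)) ≤ diskRobinCountRow σ c k μ ∧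
        diskRobinCountRow σ c k μ ≤ latticeCountRow c k (μ + C * μ ^ (-(3:ℝ)/7)) := by
  have hpi := Real.pi_gt_three
  set K : ℝ := 2/3 + π/4 + π*σ/2 with hK
  have hK0 : 0 < K := by positivity
  refine ⟨16 * K, by positivity, 1 + 32 * K, by positivity, ?_⟩
  intro μ hμ k hk
  have hμ1 : 1 ≤ μ := by linarith
  have hμ0 : 0 < μ := by linarith
  obtain ⟨t, ht⟩ : ∃ t, t = μ ^ ((1:ℝ)/7) := ⟨_, rfl⟩
  have ht1 : 1 ≤ t := by rw [ht]; exact Real.one_le_rpow hμ1 (by norm_num)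
  have ht0 : 0 < t := by linarith
  have e7 : μ = t^7 := by
    rw [ht, ← Real.rpow_natCast, ← Real.rpow_mul hμ0.le]; norm_num
  have e4 : μ ^ ((4:ℝ)/7) = t^4 := by
    rw [ht, ← Real.rpow_natCast, ← Real.rpow_mul hμ0.le]; norm_num
  have e3 : μ ^ (-(3:ℝ)/7) = 1 / t^3 := by
    rw [ht, ← Real.rpow_natCast, ← Real.rpow_mul hμ0.le, one_div, ← Real.rpow_neg hμ0.le]; norm_num
  rw [e4] at hk
  rw [e3, mul_one_div]
  set δ := 16 * K / t^3 with hδ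
  have hδ0 : 0 < δ := by positivity
  have hδ1 : δ ≤ μ/2 := by
    have : δ ≤ 16 * K := div_le_self (by positivity) (one_le_pow₀ ht1)
    linarith
  have hk2 : 2 ≤ k := by
    have : (1:ℝ) < k := lt_of_le_of_lt (one_le_pow₀ ht1) hk
    have : 1 < k := by exact_mod_cast this
    omega
  have hk2' : (2:ℝ) ≤ k := by exact_mod_cast hk2
  obtain ⟨m, rfl⟩ : ∃ m, k = m + 1 := ⟨k - 1, by omega⟩
  have hm1 : 1 ≤ m := by omega
  push_cast at hk hk2'
  have nat_rep : ∀ n : ℤ, c * ((m+1 : ℕ) : ℝ) ≤ (n:ℝ) → ∃ N : ℕ, 1 ≤ N ∧ n = N := by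
    intro n h
    have h0 : 0 < c * ((m+1 : ℕ) : ℝ) := by positivity
    have : (0:ℝ) < n := h0.trans_le h
    have : 0 < n := by exact_mod_cast this
    exact ⟨n.toNat, by omega, by omega⟩
  have y0 : (0:ℝ) ≤ ((m+1 : ℕ) : ℝ) - 3/4 := by push_cast; linarith
  have upper : {n : ℤ | c * ((m+1 : ℕ) : ℝ) ≤ (n : ℝ) ∧
      m+1 ≤ ({t : ℝ | t ∈ Set.Ioc 0 μ ∧ phiRobin σ n.natAbs t = 0}).ncard} ⊆
      {n : ℤ | c * ((m+1 : ℕ) : ℝ) ≤ (n : ℝ) ∧ ((n : ℝ), ((m+1 : ℕ) : ℝ) - 3/4) ∈ (μ + δ) • domD} := by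
    rintro n ⟨hn, hcard⟩
    refine ⟨hn, ?_⟩
    obtain ⟨N, hN, rfl⟩ := nat_rep n hn
    have hN0 : (0:ℝ) < N := by exact_mod_cast hN
    rw [Int.natAbs_natCast] at hcard
    rw [Int.cast_natCast, dom_iff _ _ _ hN0 (by linarith) y0]
    obtain ⟨x1, hx1, -, -, R⟩ := bessel_row N hN σ hσ
    obtain ⟨r1, r2, r3⟩ := R μ m hm1 hcard
    have hNμ : (N:ℝ) < μ := hx1.trans_le r1
    refine ⟨by linarith, ?_⟩
    have hθ : t^4 ≤ bT N μ := by nlinarith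
    have := incr_est N μ (μ+δ) t K δ (bS N μ) hN0 hNμ rfl ht0 hK0 hδ (by rw [e7]; nlinarith [pow_pos ht0 7])
      e7.le hθ le_rfl
    have e14 : μ^2 = t^14 := by rw [e7]; ring
    rw [e14, ← hK] at r3
    push_cast
    linarith
  have lower : {n : ℤ | c * ((m+1 : ℕ) : ℝ) ≤ (n : ℝ) ∧ ((n : ℝ), ((m+1 : ℕ) : ℝ) - 3/4) ∈ (μ - δ) • domD} ⊆
      {n : ℤ | c * ((m+1 : ℕ) : ℝ) ≤ (n : ℝ) ∧
      m+1 ≤ ({t : ℝ | t ∈ Set.Ioc 0 μ ∧ phiRobin σ n.natAbs t = 0}).ncard} := by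
    rintro n ⟨hn, hd⟩
    refine ⟨hn, ?_⟩
    obtain ⟨N, hN, rfl⟩ := nat_rep n hn
    have hN0 : (0:ℝ) < N := by exact_mod_cast hN
    rw [Int.natAbs_natCast]
    rw [Int.cast_natCast, dom_iff _ _ _ hN0 (by linarith) y0] at hd
    obtain ⟨d1, d2⟩ := hd
    push_cast at d2
    obtain ⟨x1, hx1, t1, R, -⟩ := bessel_row N hN σ hσ
    have hθ : (m:ℝ) + 1 ≤ bT N (μ - δ) := by nlinarith
    have hx : x1 ≤ μ - δ := by
      by_contra hh
      have := (bT_mono hN0).monotoneOn d1 hx1.le (not_le.1 hh).le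
      linarith
    have hNM : (N:ℝ) < μ - δ := hx1.trans_le hx
    apply R μ (by linarith) m
    have := incr_est N (μ-δ) μ t K δ (bS N μ) hN0 hNM (by ring) ht0 hK0 hδ (by rw [← e7]; linarith)
      (by rw [← e7]; linarith) (by linarith) (bS_mono hN0 d1 (by linarith))
    have e14 : μ^2 = t^14 := by rw [e7]; ring
    rw [e14, ← hK]
    linarith
  have fin : ({n : ℤ | c * ((m+1 : ℕ) : ℝ) ≤ (n : ℝ) ∧ ((n : ℝ), ((m+1 : ℕ) : ℝ) - 3/4) ∈ (μ + δ) • domD}).Finite := by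
    refine (Set.finite_Icc (0:ℤ) ⌈μ+δ⌉).subset ?_
    rintro n ⟨hn, hd⟩
    obtain ⟨N, hN, rfl⟩ := nat_rep n hn
    have hN0 : (0:ℝ) < N := by exact_mod_cast hN
    rw [Int.cast_natCast, dom_iff _ _ _ hN0 (by linarith) y0] at hd
    refine ⟨by omega, ?_⟩
    have : ((N:ℤ):ℝ) ≤ ⌈μ+δ⌉ := by
      rw [Int.cast_natCast]; exact hd.1.trans (Int.le_ceil _)
    exact_mod_cast this
  exact ⟨Set.ncard_le_ncard lower (fin.subset upper), Set.ncard_le_ncard upper fin⟩
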